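/- arXiv:1406.0766 — 5 statements merged into one kernel-verified Lean document; each statement's English description precedes it below -/
import Mathlib

section
/- Let d ≥ 2 be an integer and t > 0 a real number. Then ∫_{−2√(d−1)}^{2√(d−1)} (1/2)·ln(1+t·x²) · f_d(x) dx = (1/2)·ln S_d(t), where η_t = (√(1+4(d−1)t) − 1)/(2(d−1)t) and S_d(t) = (1/η_t²)·((d−1)/(d−η_t))^{d−2}, and f_d is the Kesten–McKay density. -/
open InnerProductSpace Real in
/-- Averaging a harmonic function over the unit circle against the Kesten–McKay weight in the
angular coordinate. -/
theorem circleAverage_kestenMcKay_weight {g : ℂ → ℝ}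
    (hg : HarmonicOnNhd g (Metric.closedBall 0 1)) (q : ℝ) (hq : 1 ≤ q) :
    circleAverage (fun z ↦ ((q + 1) / 2) * g z
        - ((q - 1) / 2) * (poissonKernel 0 ((q⁻¹ : ℝ) : ℂ) z * g z)) 0 1
      = ((q + 1) / 2) * g 0 - ((q - 1) / 2) * g ((q⁻¹ : ℝ) : ℂ) := by
  have hgc : ContinuousOn g (Metric.sphere 0 1) := fun z hz ↦
    (hg z (Metric.sphere_subset_closedBall hz)).1.continuousAt.continuousWithinAt
  have hmean : circleAverage g 0 1 = g 0 :=
    InnerProductSpace.HarmonicOnNhd.circleAverage_eq (by simpa using hg)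
  rcases hq.eq_or_lt with rfl | hq
  · simpa using hmean
  have hq0 : 0 < q := by linarith
  have hw : ((q⁻¹ : ℝ) : ℂ) ∈ Metric.ball (0 : ℂ) 1 := by
    rw [mem_ball_zero_iff, Complex.norm_real, norm_of_nonneg (by positivity)]
    exact inv_lt_one_of_one_lt₀ hq
  have hP : ContinuousOn (poissonKernel 0 ((q⁻¹ : ℝ) : ℂ)) (Metric.sphere 0 1) := by
    rw [poissonKernel_eq_re_herglotzRieszKernel]
    exact Complex.continuous_re.comp_continuousOn
      (by simpa using continuousOn_herglotzRieszKernel_sphere hw)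
  have hpoisson := hg.circleAverage_poissonKernel_smul hw
  rw [circleAverage_fun_sub
    (ContinuousOn.circleIntegrable zero_le_one (by fun_prop))
    (ContinuousOn.circleIntegrable zero_le_one (by fun_prop))]
  have h1 := circleAverage_fun_smul (a := (q + 1) / 2) (f := g) (c := 0) (R := 1)
  have h2 := circleAverage_fun_smul (a := (q - 1) / 2)
    (f := poissonKernel 0 ((q⁻¹ : ℝ) : ℂ) • g) (c := 0) (R := 1)
  rw [hmean] at h1
  rw [hpoisson] at h2
  simp only [smul_eq_mul, Pi.smul_apply'] at h1 h2
  rw [h1, h2]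

theorem norm_one_add_mul_circleMap_sq (s θ : ℝ) :
    ‖1 + (s : ℂ) * circleMap 0 1 θ‖ ^ 2 = 1 + s ^ 2 + 2 * s * Real.cos θ := by
  rw [← Complex.normSq_eq_norm_sq, Complex.normSq_apply]
  have h : circleMap 0 1 θ = ⟨Real.cos θ, Real.sin θ⟩ := by
    apply Complex.ext <;> simp [circleMap, Complex.exp_ofReal_mul_I_re, Complex.exp_ofReal_mul_I_im]
  rw [h]
  simp
  linear_combination s ^ 2 * Real.sin_sq_add_cos_sq θ

open InnerProductSpace in
theorem harmonicOnNhd_log_norm_one_add_mul_sub {s : ℝ} (hs0 : 0 ≤ s) (hs1 : s < 1) (c : ℝ) :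
    HarmonicOnNhd (fun z : ℂ ↦ Real.log ‖1 + (s : ℂ) * z‖ - c) (Metric.closedBall 0 1) := by
  intro z hz
  have hne : 1 + (s : ℂ) * z ≠ 0 := by
    intro h
    have h1 : ‖(s : ℂ) * z‖ = 1 := by
      rw [show (s : ℂ) * z = -1 by linear_combination h]; simp
    rw [norm_mul, Complex.norm_real, Real.norm_of_nonneg hs0] at h1
    have := mem_closedBall_zero_iff.1 hz
    nlinarith
  have hlog : HarmonicAt (fun z : ℂ ↦ Real.log ‖1 + (s : ℂ) * z‖) z :=
    AnalyticAt.harmonicAt_log_norm (f := fun z : ℂ ↦ 1 + (s : ℂ) * z) (by fun_prop) hne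
  exact hlog.sub (harmonicAt_const c)

/-- The substitution `x = -2√q cos (θ / 2)` turns the Kesten–McKay density into a combination of
the uniform density and the Poisson kernel on the circle. -/
theorem kestenMcKay_density_substitution {q θ : ℝ} (hq : 1 ≤ q)
    (hθ : θ ∈ Set.Ioo 0 (2 * Real.pi)) :
    (q + 1) * Real.sqrt (4 * q - (-(2 * Real.sqrt q * Real.cos (θ / 2))) ^ 2) /
        (2 * Real.pi * ((q + 1) ^ 2 - (-(2 * Real.sqrt q * Real.cos (θ / 2))) ^ 2)) *
        (Real.sqrt q * Real.sin (θ / 2))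
      = (2 * Real.pi)⁻¹ * ((q + 1) / 2
          - (q - 1) / 2 * poissonKernel 0 ((q⁻¹ : ℝ) : ℂ) (circleMap 0 1 θ)) := by
  have hpi := Real.pi_pos
  have hq0 : 0 < q := by linarith
  have hsin : 0 < Real.sin (θ / 2) :=
    Real.sin_pos_of_pos_of_lt_pi (by linarith [hθ.1]) (by linarith [hθ.2])
  have hsq : Real.sqrt q ^ 2 = q := Real.sq_sqrt hq0.le
  have hcs := Real.sin_sq_add_cos_sq (θ / 2)
  have hcos : Real.cos θ = 1 - 2 * Real.sin (θ / 2) ^ 2 := by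
    rw [show θ = 2 * (θ / 2) by ring, Real.cos_two_mul, show 2 * (θ / 2) / 2 = θ / 2 by ring]
    linarith
  have hx : (-(2 * Real.sqrt q * Real.cos (θ / 2))) ^ 2
      = 4 * q * (1 - Real.sin (θ / 2) ^ 2) := by
    rw [neg_sq, mul_pow, mul_pow, hsq]
    linear_combination (4 * q) * hcs
  have hroot : Real.sqrt (4 * q - 4 * q * (1 - Real.sin (θ / 2) ^ 2))
      = 2 * Real.sqrt q * Real.sin (θ / 2) := by
    rw [Real.sqrt_eq_iff_mul_self_eq_of_pos (by positivity)]
    linear_combination (4 * Real.sin (θ / 2) ^ 2) * hsq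
  have hnorm : ‖circleMap 0 1 θ - ((q⁻¹ : ℝ) : ℂ)‖ ^ 2
      = ((q - 1) ^ 2 + 4 * q * Real.sin (θ / 2) ^ 2) / q ^ 2 := by
    have h := norm_one_add_mul_circleMap_sq (-q) θ
    have h' : (1 : ℂ) + ((-q : ℝ) : ℂ) * circleMap 0 1 θ
        = -(q : ℂ) * (circleMap 0 1 θ - ((q⁻¹ : ℝ) : ℂ)) := by
      have : (q : ℂ) ≠ 0 := by exact_mod_cast hq0.ne'
      push_cast
      field_simp
      ring
    rw [h', norm_mul, norm_neg, Complex.norm_real, Real.norm_of_nonneg hq0.le, hcos] at h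
    rw [eq_div_iff (by positivity)]
    linear_combination h
  have hP : poissonKernel 0 ((q⁻¹ : ℝ) : ℂ) (circleMap 0 1 θ)
      = (q ^ 2 - 1) / ((q - 1) ^ 2 + 4 * q * Real.sin (θ / 2) ^ 2) := by
    rw [poissonKernel_def]
    simp only [sub_zero]
    rw [hnorm, norm_circleMap_zero, Complex.norm_real, Real.norm_of_nonneg (by positivity)]
    field_simp
    simp
  have hden : 0 < (q - 1) ^ 2 + 4 * q * Real.sin (θ / 2) ^ 2 := by positivity
  rw [hP, hx, hroot, show (q + 1) ^ 2 - 4 * q * (1 - Real.sin (θ / 2) ^ 2)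
    = (q - 1) ^ 2 + 4 * q * Real.sin (θ / 2) ^ 2 by ring]
  field_simp
  rw [hsq]
  ring

open Real in
/-- The Kesten–McKay average of `log (1 + t x²) / 2`, in terms of the root `η` of
`q t η² + η = 1`. -/
theorem kestenMcKay_log_integral_of_root {q t η : ℝ} (hq : 1 ≤ q) (hη0 : 0 < η) (hη1 : η < 1)
    (hroot : q * t * η ^ 2 + η = 1) :
    ∫ x in (-(2 * √q))..(2 * √q),
        ((1 / 2) * log (1 + t * x ^ 2)) *
          ((q + 1) * √(4 * q - x ^ 2) / (2 * π * ((q + 1) ^ 2 - x ^ 2)))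
      = -log η - (q - 1) / 2 * log ((q + 1 - η) / q) := by
  have hpi := Real.pi_pos
  have hq0 : 0 < q := by linarith
  set g : ℂ → ℝ := fun z ↦ log ‖1 + ((1 - η : ℝ) : ℂ) * z‖ - log η with hg
  have havg := circleAverage_kestenMcKay_weight
    (harmonicOnNhd_log_norm_one_add_mul_sub (s := 1 - η) (by linarith) (by linarith) (log η)) q hq
  have hg0 : g 0 = -log η := by simp [hg]
  have hgq : g ((q⁻¹ : ℝ) : ℂ) = log ((q + 1 - η) / q) - log η := by
    have : (1 : ℂ) + ((1 - η : ℝ) : ℂ) * ((q⁻¹ : ℝ) : ℂ) = (((q + 1 - η) / q : ℝ) : ℂ) := by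
      have : (q : ℂ) ≠ 0 := by exact_mod_cast hq0.ne'
      push_cast
      field_simp
      ring
    simp only [hg]
    rw [this, Complex.norm_real, Real.norm_of_nonneg (div_nonneg (by linarith) hq0.le)]
  have hlog (θ : ℝ) : (1 / 2) * log (1 + t * (-(2 * √q * cos (θ / 2))) ^ 2)
      = g (circleMap 0 1 θ) := by
    have h1 : 1 + t * (-(2 * √q * cos (θ / 2))) ^ 2
        = ‖1 + ((1 - η : ℝ) : ℂ) * circleMap 0 1 θ‖ ^ 2 / η ^ 2 := by
      rw [norm_one_add_mul_circleMap_sq, eq_div_iff (by positivity),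
        show cos θ = 2 * cos (θ / 2) ^ 2 - 1 by rw [← cos_two_mul]; congr 1; ring,
        neg_sq, mul_pow, mul_pow, sq_sqrt hq0.le]
      linear_combination (4 * cos (θ / 2) ^ 2) * hroot
    have hne : ‖1 + ((1 - η : ℝ) : ℂ) * circleMap 0 1 θ‖ ^ 2 ≠ 0 := by
      rw [norm_one_add_mul_circleMap_sq]
      nlinarith [neg_one_le_cos θ, sq_pos_of_pos hη0]
    rw [h1, log_div hne (by positivity), log_pow, log_pow]
    simp only [hg]
    push_cast
    ring
  have hsubst := intervalIntegral.integral_comp_mul_deriv_of_deriv_nonneg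
    (a := 0) (b := 2 * π) (f := fun θ ↦ -(2 * √q * cos (θ / 2)))
    (f' := fun θ ↦ √q * sin (θ / 2))
    (g := fun x ↦ ((1 / 2) * log (1 + t * x ^ 2)) *
      ((q + 1) * √(4 * q - x ^ 2) / (2 * π * ((q + 1) ^ 2 - x ^ 2))))
    (by fun_prop)
    (fun θ _ ↦ by
      have h : HasDerivAt (fun θ ↦ -(2 * √q * cos (θ / 2)))
          (-(2 * √q * (-sin (θ / 2) * (1 / 2)))) θ :=
        (((hasDerivAt_id θ).div_const 2).cos.const_mul (2 * √q)).neg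
      convert h using 1
      ring)
    (fun θ hθ ↦ by
      rw [min_eq_left (by positivity), max_eq_right (by positivity)] at hθ
      exact mul_nonneg (sqrt_nonneg q)
        (sin_nonneg_of_nonneg_of_le_pi (by linarith [hθ.1]) (by linarith [hθ.2])))
  simp only [zero_div, cos_zero, mul_one, mul_div_cancel_left₀ π (two_ne_zero' ℝ), cos_pi,
    mul_neg, neg_neg] at hsubst
  rw [← hsubst]
  rw [circleAverage_def, smul_eq_mul, ← intervalIntegral.integral_const_mul] at havg
  trans ((q + 1) / 2) * g 0 - ((q - 1) / 2) * g ((q⁻¹ : ℝ) : ℂ)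
  · rw [← havg]
    refine intervalIntegral.integral_congr_Ioo_of_le (by positivity) fun θ hθ ↦ ?_
    simp only [Function.comp_apply]
    rw [hlog, mul_assoc, kestenMcKay_density_substitution hq hθ]
    simp only [hg]
    ring
  · rw [hg0, hgq]
    ring

/-- The density function of the infinite `d`-regular tree (the Kesten–McKay measure)
integrated against `(1/2)ln(1+t x²)` gives `(1/2)ln S_d(t)`. -/
theorem kestenMcKay_log_integral (d : ℕ) (hd : 2 ≤ d) (t : ℝ) (ht : 0 < t) (η S : ℝ)
    (hη : η = (Real.sqrt (1 + 4 * ((d : ℝ) - 1) * t) - 1) / (2 * ((d : ℝ) - 1) * t))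
    (hS : S = (1 / η ^ 2) * (((d : ℝ) - 1) / ((d : ℝ) - η)) ^ (d - 2)) :
    ∫ x in (-(2 * Real.sqrt ((d : ℝ) - 1)))..(2 * Real.sqrt ((d : ℝ) - 1)),
        ((1 / 2) * Real.log (1 + t * x ^ 2)) *
          ((d : ℝ) * Real.sqrt (4 * ((d : ℝ) - 1) - x ^ 2) /
            (2 * Real.pi * ((d : ℝ) ^ 2 - x ^ 2)))
      = (1 / 2) * Real.log S := by
  have hd' : (2 : ℝ) ≤ d := by exact_mod_cast hd
  have hq : (1 : ℝ) ≤ (d : ℝ) - 1 := by linarith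
  set q : ℝ := (d : ℝ) - 1 with hq_def
  have hdq : (d : ℝ) = q + 1 := by rw [hq_def]; ring
  have hqt : 0 < q * t := by positivity
  have hs : Real.sqrt (1 + 4 * q * t) ^ 2 = 1 + 4 * q * t := Real.sq_sqrt (by linarith)
  have hs1 : 1 < Real.sqrt (1 + 4 * q * t) := Real.lt_sqrt_of_sq_lt (by linarith)
  have hη0 : 0 < η := by
    rw [hη]
    exact div_pos (by linarith) (by linarith)
  have hroot : q * t * η ^ 2 + η = 1 := by
    have h : 2 * q * t * η = Real.sqrt (1 + 4 * q * t) - 1 := by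
      rw [hη]
      field_simp
    have h' : 4 * (q * t) * (q * t * η ^ 2 + η - 1) = 0 := by
      linear_combination (2 * q * t * η + 1 + Real.sqrt (1 + 4 * q * t)) * h + hs
    have := (mul_eq_zero.1 h').resolve_left (by positivity)
    linarith
  have hη1 : η < 1 := by nlinarith [mul_pos hqt (pow_pos hη0 2)]
  rw [hdq, kestenMcKay_log_integral_of_root hq hη0 hη1 hroot, hS, hdq]
  have hpos : 0 < q + 1 - η := by linarith
  rw [Real.log_mul (by positivity) (by positivity), Real.log_pow, one_div (η ^ 2), Real.log_inv,
    Real.log_pow, ← inv_div (q + 1 - η) q, Real.log_inv, Nat.cast_sub hd, hdq]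
  push_cast
  ring
end

section
/- Let d ≥ 2 and n ≥ 1 be integers, let 0 ≤ k < n, and set p = k/n and p_μ = binom(n,k)·p^k·(1−p)^{n−k}. Then binom(n,k)^2 · d^{2k} / binom(dn,k) ≤ √((1−p/d)/(1−p)) · p_μ · exp(2n·Γ_d(p)). -/
/-- The entropy function `Γ_d(p)` of the infinite `d`-regular tree.
(In Lean, `Real.log 0 = 0`, which implements the convention `0 · ln 0 = 0`.) -/
noncomputable def Gammad (d : ℕ) (p : ℝ) : ℝ :=
  (1 / 2) * (p * Real.log ((d : ℝ) / p) + ((d : ℝ) - p) * Real.log (1 - p / d)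
    - 2 * (1 - p) * Real.log (1 - p))

open Stirling in
/-- The consecutive differences `log (stirlingSeq m) - log (stirlingSeq (m + 1))` decrease. -/
theorem antitone_log_stirlingSeq_diff :
    Antitone fun m : ℕ => Real.log (stirlingSeq (m + 1)) - Real.log (stirlingSeq (m + 2)) := by
  intro a b hab
  refine hasSum_le (fun j => ?_) (log_stirlingSeq_sdiff_hasSum b) (log_stirlingSeq_sdiff_hasSum a)
  gcongr

open Stirling in
theorem log_stirlingSeq_sub_le (r R k : ℕ) (h : r ≤ R) :
    Real.log (stirlingSeq (r + k + 1)) - Real.log (stirlingSeq (r + 1)) ≤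
      Real.log (stirlingSeq (R + k + 1)) - Real.log (stirlingSeq (R + 1)) := by
  induction k with
  | zero => simp
  | succ k ih =>
    have := antitone_log_stirlingSeq_diff (show r + k ≤ R + k by lia)
    simp only [← add_assoc, add_right_comm _ 1 1] at this ⊢
    linarith

open Stirling in
theorem stirlingSeq_mul_le (r R k : ℕ) (hr : 0 < r) (h : r ≤ R) :
    stirlingSeq (r + k) * stirlingSeq R ≤ stirlingSeq (R + k) * stirlingSeq r := by
  obtain ⟨r, rfl⟩ := Nat.exists_eq_add_of_lt hr
  obtain ⟨R, rfl⟩ := Nat.exists_eq_add_of_lt (hr.trans_le h)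
  simp only [zero_add] at h ⊢
  have key := log_stirlingSeq_sub_le r R k (by lia)
  rw [add_right_comm r 1 k, add_right_comm R 1 k]
  have h1 := stirlingSeq'_pos (r + k)
  have h2 := stirlingSeq'_pos R
  have h3 := stirlingSeq'_pos (R + k)
  have h4 := stirlingSeq'_pos r
  rw [← Real.log_le_log_iff (by positivity) (by positivity),
    Real.log_mul h1.ne' h2.ne', Real.log_mul h3.ne' h4.ne']
  linarith

theorem factorial_eq_stirlingSeq_mul (m : ℕ) (hm : 0 < m) :
    (m.factorial : ℝ) =
      Stirling.stirlingSeq m * (Real.sqrt 2 * Real.sqrt m * (m ^ m / Real.exp 1 ^ m)) := by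
  have : (0 : ℝ) < m := by exact_mod_cast hm
  rw [Stirling.stirlingSeq, Real.sqrt_mul (by norm_num), div_pow]
  field_simp

/-- A Stirling-type comparison of the two ratios `(r + k)! / r!` and `(R + k)! / R!`. -/
theorem factorial_mul_le (r R k : ℕ) (hr : 0 < r) (h : r ≤ R) :
    ((r + k).factorial : ℝ) * R.factorial *
        (Real.sqrt r * Real.sqrt (R + k) * (r ^ r * (R + k) ^ (R + k))) ≤
      ((R + k).factorial : ℝ) * r.factorial *
        (Real.sqrt (r + k) * Real.sqrt R * ((r + k) ^ (r + k) * R ^ R)) := by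
  have key := stirlingSeq_mul_le r R k hr h
  rw [factorial_eq_stirlingSeq_mul _ hr, factorial_eq_stirlingSeq_mul R (by lia),
    factorial_eq_stirlingSeq_mul (r + k) (by lia), factorial_eq_stirlingSeq_mul (R + k) (by lia)]
  push_cast
  set c : ℝ := Real.sqrt 2 ^ 2 / (Real.exp 1 ^ (r + R + k)) *
    (Real.sqrt r * Real.sqrt (R + k) * (r ^ r * (R + k) ^ (R + k))) *
    (Real.sqrt (r + k) * Real.sqrt R * ((r + k) ^ (r + k) * R ^ R)) with hc
  have hc0 : 0 ≤ c := by positivity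
  have := mul_le_mul_of_nonneg_right key hc0
  have e : Real.exp 1 ≠ 0 := (Real.exp_pos 1).ne'
  refine le_of_eq_of_le ?_ (this.trans_eq ?_) <;>
  · rw [hc]
    field_simp
    ring

theorem cast_choose_div_cast_choose (r R k : ℕ) :
    ((r + k).choose k : ℝ) / ((R + k).choose k : ℝ) =
      ((r + k).factorial * R.factorial) / ((R + k).factorial * r.factorial) := by
  rw [Nat.cast_choose ℝ (Nat.le_add_left k r), Nat.cast_choose ℝ (Nat.le_add_left k R),
    Nat.add_sub_cancel, Nat.add_sub_cancel]
  field_simp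

theorem choose_div_choose_le (r R k : ℕ) (hr : 0 < r) (h : r ≤ R) :
    ((r + k).choose k : ℝ) / ((R + k).choose k : ℝ) ≤
      Real.sqrt ((R / (R + k)) / (r / (r + k))) *
        ((r + k) ^ (r + k) * R ^ R / (r ^ r * (R + k) ^ (R + k))) := by
  have hr0 : (0 : ℝ) < r := by exact_mod_cast hr
  have hR0 : (0 : ℝ) < R := by exact_mod_cast hr.trans_le h
  have key := factorial_mul_le r R k hr h
  rw [cast_choose_div_cast_choose, Real.sqrt_div (by positivity), Real.sqrt_div (by positivity),
    Real.sqrt_div (by positivity), div_div_div_eq, div_mul_div_comm,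
    div_le_div_iff₀ (by positivity) (by positivity)]
  linarith

theorem exp_mul_log_eq_pow (m : ℕ) {x : ℝ} (hx : 0 < x) :
    Real.exp (m * Real.log x) = x ^ m := by
  rw [Real.exp_nat_mul, Real.exp_log hx]

/-- The exponential of `2n·Γ_d(k/n)` in closed form, with `n = r + k` and `d * n = R + k`. -/
theorem pow_mul_exp_Gammad (d r R k : ℕ) (hd : 0 < d) (hr : 0 < r) (hR : 0 < R)
    (h : d * (r + k) = R + k) (p : ℝ) (hp : p = (k : ℝ) / (r + k : ℕ)) :
    p ^ k * Real.exp (2 * (r + k : ℕ) * Gammad d p) =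
      d ^ k * (1 - p / d) ^ R / ((1 - p) ^ r * (1 - p) ^ r) := by
  have hr0 : (0 : ℝ) < r := by exact_mod_cast hr
  have hR0 : (0 : ℝ) < R := by exact_mod_cast hR
  have hd0 : (0 : ℝ) < d := by exact_mod_cast hd
  have hc : (d : ℝ) * (r + k) = R + k := by exact_mod_cast h
  have hn0 : (0 : ℝ) < (r : ℝ) + k := by positivity
  have hpn : p * (r + k) = k := by rw [hp]; push_cast; field_simp
  have h1 : 1 - p = r / (r + k) := by rw [eq_div_iff hn0.ne']; linarith
  have h2 : 1 - p / d = R / (R + k) := by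
    rw [← hc, eq_div_iff (by positivity)]
    field_simp
    linarith
  have hq : 0 < 1 - p := by rw [h1]; positivity
  have hs : 0 < 1 - p / d := by rw [h2]; positivity
  have hexp : 2 * ((r + k : ℕ) : ℝ) * Gammad d p = k * Real.log (d / p) +
      R * Real.log (1 - p / d) - (r * Real.log (1 - p) + r * Real.log (1 - p)) := by
    have e1 : (r + k : ℝ) * (d - p) = R := by linarith
    have e2 : (r + k : ℝ) * (1 - p) = r := by linarith
    rw [Gammad]
    push_cast
    linear_combination Real.log (d / p) * hpn + Real.log (1 - p / d) * e1
      - 2 * Real.log (1 - p) * e2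
  have hk : p ^ k * Real.exp (k * Real.log (d / p)) = d ^ k := by
    rcases Nat.eq_zero_or_pos k with rfl | hk
    · simp
    · have hk0 : (0 : ℝ) < k := by exact_mod_cast hk
      have hp0 : 0 < p := by rw [hp]; positivity
      rw [exp_mul_log_eq_pow k (by positivity), ← mul_pow, mul_div_cancel₀ _ hp0.ne']
  rw [hexp, Real.exp_sub, Real.exp_add, Real.exp_add, exp_mul_log_eq_pow r hq,
    exp_mul_log_eq_pow R hs, ← hk]
  ring

/-- The expected number of `k`-matchings of a random `d`-regular bipartite graph on `2n`
vertices in the configuration model, `binom(n,k)² d^(2k) / binom(dn,k)`, is at most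
`√((1-p/d)/(1-p)) · p_μ · exp(2n·Γ_d(p))`. -/
theorem expected_matchings_upper_bound (d n : ℕ) (hd : 2 ≤ d) (hn : 1 ≤ n)
    (k : ℕ) (hk : k < n) (p pμ : ℝ) (hp : p = (k : ℝ) / n)
    (hpμ : pμ = (n.choose k : ℝ) * p ^ k * (1 - p) ^ (n - k)) :
    (n.choose k : ℝ) ^ 2 * (d : ℝ) ^ (2 * k) / ((d * n).choose k : ℝ) ≤
      Real.sqrt ((1 - p / d) / (1 - p)) * pμ * Real.exp (2 * n * Gammad d p) := by
  obtain ⟨r, rfl⟩ := Nat.exists_eq_add_of_le' hk.le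
  have hr : 0 < r := by lia
  have hle : r + k ≤ d * (r + k) := Nat.le_mul_of_pos_left _ (by lia)
  obtain ⟨R, hR⟩ := Nat.exists_eq_add_of_le' ((Nat.le_add_left k r).trans hle)
  have hrR : r ≤ R := by lia
  have hr0 : (0 : ℝ) < r := by exact_mod_cast hr
  have hR0 : (0 : ℝ) < R := by exact_mod_cast hr.trans_le hrR
  have hd0 : (0 : ℝ) < d := by positivity
  have hc : (d : ℝ) * (r + k) = R + k := by exact_mod_cast hR
  have h1 : 1 - p = r / (r + k) := by
    rw [hp]
    push_cast
    field_simp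
    ring
  have h2 : 1 - p / d = R / (R + k) := by
    rw [hp, ← hc]
    push_cast
    field_simp
    linarith
  have hexp := pow_mul_exp_Gammad d r R k (by lia) hr (hr.trans_le hrR) hR p hp
  have key := choose_div_choose_le r R k hr hrR
  have hrhs : Real.sqrt ((1 - p / d) / (1 - p)) * pμ *
      Real.exp (2 * (r + k : ℕ) * Gammad d p) =
      ((r + k).choose k * d ^ (2 * k)) * (Real.sqrt ((R / (R + k)) / (r / (r + k))) *
        ((r + k) ^ (r + k) * R ^ R / (r ^ r * (R + k) ^ (R + k)))) := by
    calc _ = Real.sqrt ((1 - p / d) / (1 - p)) * (r + k).choose k * (1 - p) ^ r *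
          (p ^ k * Real.exp (2 * (r + k : ℕ) * Gammad d p)) := by
          rw [hpμ, Nat.add_sub_cancel]
          ring
      _ = _ := by
          rw [hexp, h1, h2, ← hc, pow_add _ R k, pow_add _ r k, mul_pow (d : ℝ) _ k, two_mul,
            pow_add (d : ℝ) k k]
          simp only [div_pow]
          field_simp
  rw [hrhs, hR]
  calc _ = ((r + k).choose k * (d : ℝ) ^ (2 * k)) *
        (((r + k).choose k : ℝ) / ((R + k).choose k : ℝ)) := by ring
    _ ≤ _ := by gcongr
end

section
/- Let n ≥ 1 and let 0 ≤ k ≤ n be an integer. Let a_0, a_1, …, a_n be nonnegative reals with Σ_{j=0}^n a_j = 1 and Σ_{j=0}^n j·a_j = k, and suppose the polynomial Σ_{j=0}^n a_j x^j has only real roots. Then a_k ≥ binom(n,k)·(k/n)^k·((n−k)/n)^{n−k}, with the convention 0^0 = 1. -/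
open Polynomial

/-- A polynomial whose coefficients, divided by the binomial coefficients of `n`, form a nonnegative
log-concave sequence without internal zeros. -/
def IsUltraLogConcave (n : ℕ) (P : ℝ[X]) : Prop :=
  ∃ b : ℕ → ℝ, (∀ j, 0 ≤ b j) ∧ (∀ j, n < j → b j = 0) ∧
    (∀ j, P.coeff j = n.choose j * b j) ∧
    (∀ j, b j * b (j + 2) ≤ b (j + 1) ^ 2) ∧
    ∀ i j k, i ≤ j → j ≤ k → b j = 0 → b i * b k = 0

/-- In a log-concave sequence, the product of two neighbours dominates that of the outer
neighbours. -/
lemma mul_le_mul_of_logConcave {x y z w : ℝ} (hy : 0 ≤ y) (hz : 0 ≤ z) (hw : 0 ≤ w)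
    (h₁ : x * z ≤ y ^ 2) (h₂ : y * w ≤ z ^ 2) (hy' : y = 0 → x * w = 0)
    (hz' : z = 0 → x * w = 0) : x * w ≤ y * z := by
  rcases hy.eq_or_lt with h | h
  · rw [hy' h.symm]; positivity
  rcases hz.eq_or_lt with h' | h'
  · rw [hz' h'.symm]; positivity
  refine le_of_mul_le_mul_right ?_ (mul_pos h h')
  nlinarith [mul_le_mul h₁ h₂ (by positivity) (by positivity)]

/-- The Newton inequality at one index is preserved under multiplication by `q + p X`. -/
lemma newton_step {t M p q x y z w : ℝ} (ht : 0 ≤ t) (hM : 1 ≤ M) (hp : 0 ≤ p) (hq : 0 ≤ q)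
    (h₁ : t * (x * z) ≤ t * y ^ 2) (h₂ : y * w ≤ z ^ 2) (h₃ : t * (x * w) ≤ t * (y * z)) :
    ((M + 1) * q * y + t * p * x) * ((M - 1) * q * w + (t + 2) * p * z) ≤
      (M * q * z + (t + 1) * p * y) ^ 2 := by
  have e₁ := mul_le_mul_of_nonneg_left h₁ (show 0 ≤ (t + 2) * p ^ 2 by positivity)
  have e₂ := mul_le_mul_of_nonneg_left h₂
    (show 0 ≤ (M + 1) * (M - 1) * q ^ 2 from
      mul_nonneg (mul_nonneg (by linarith) (by linarith)) (sq_nonneg q))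
  have e₃ := mul_le_mul_of_nonneg_left h₃
    (show 0 ≤ (M - 1) * (p * q) from mul_nonneg (by linarith) (by positivity))
  nlinarith [sq_nonneg (q * z - p * y)]

lemma IsUltraLogConcave.mul_linear {n : ℕ} {P : ℝ[X]} (h : IsUltraLogConcave n P) {p q : ℝ}
    (hp : 0 ≤ p) (hq : 0 ≤ q) : IsUltraLogConcave (n + 1) (P * (C p * X + C q)) := by
  obtain ⟨b, hb, hb0, hc, hl, hz⟩ := h
  have hn : (0 : ℝ) < n + 1 := by positivity
  set d : ℕ → ℝ := fun j => ((n : ℝ) + 1 - j) * q * b j + j * p * b (j - 1) with hd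
  have hd0 : ∀ j, n + 1 < j → d j = 0 := fun j hj => by
    simp only [hd]
    rw [hb0 j (by omega), hb0 (j - 1) (by omega)]; ring
  have hdpos : ∀ j, 0 ≤ d j := fun j => by
    rcases lt_or_ge (n + 1) j with hj | hj
    · exact (hd0 j hj).ge
    · have : (j : ℝ) ≤ n + 1 := by exact_mod_cast hj
      exact add_nonneg (mul_nonneg (mul_nonneg (by linarith) hq) (hb _))
        (mul_nonneg (by positivity) (hb _))
  refine ⟨fun j => d j / (n + 1), fun j => div_nonneg (hdpos j) hn.le, fun j hj => ?_,
    fun j => ?_, fun j => ?_, fun i j k hij hjk h => ?_⟩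
  · simp [hd0 j hj]
  · rw [mul_add, ← mul_assoc, coeff_add, coeff_mul_C]
    cases j with
    | zero => simp [hc, hd]; field_simp
    | succ j =>
      rw [coeff_mul_X, coeff_mul_C, hc, hc]
      have e₁ : ((n + 1).choose (j + 1) : ℝ) * (j + 1) = (n + 1) * n.choose j := by
        exact_mod_cast (Nat.add_one_mul_choose_eq n j).symm
      have e₂ : ((n + 1).choose (j + 1) : ℝ) = n.choose j + n.choose (j + 1) := by
        exact_mod_cast Nat.choose_succ_succ n j
      simp only [hd, Nat.add_sub_cancel]
      push_cast
      field_simp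
      linear_combination (-q * b (j + 1) * (n + 1)) * e₂ + (q * b (j + 1) - p * b j) * e₁
  · rw [div_mul_div_comm, div_pow, ← sq]
    gcongr
    rcases lt_or_ge j n with hj | hj
    · have hM : (1 : ℝ) ≤ n - j := by
        have : ((j + 1 : ℕ) : ℝ) ≤ n := by exact_mod_cast hj
        push_cast at this; linarith
      have := newton_step (t := j) (M := n - j) (x := b (j - 1)) (y := b j) (z := b (j + 1))
        (w := b (j + 2)) (by positivity) hM hp hq ?_ (hl j) ?_
      · refine le_of_eq_of_le ?_ (this.trans_eq ?_) <;>
          simp only [hd, show j + 1 - 1 = j from rfl, show j + 2 - 1 = j + 1 from rfl] <;>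
          push_cast <;> ring
      · cases j with
        | zero => simp
        | succ j => exact mul_le_mul_of_nonneg_left (hl j) (by positivity)
      · cases j with
        | zero => simp
        | succ j =>
          exact mul_le_mul_of_nonneg_left (mul_le_mul_of_logConcave (hb _) (hb _) (hb _)
            (hl j) (hl (j + 1)) (hz _ _ _ (by simp) (by omega))
            (hz _ _ _ (by simp; omega) (by omega))) (by positivity)
    · rw [hd0 (j + 2) (by omega), mul_zero]; positivity
  · rw [div_mul_div_comm, div_eq_zero_iff]
    left
    have hdj : d j = 0 := by simpa [hn.ne'] using h
    rcases hij.eq_or_lt with rfl | hij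
    · rw [hdj, zero_mul]
    rcases hjk.eq_or_lt with rfl | hjk
    · rw [hdj, mul_zero]
    rcases lt_or_ge (n + 1) k with hk | hk
    · rw [hd0 k hk, mul_zero]
    have hj : (0 : ℝ) < n + 1 - j := by
      have : (j : ℝ) < k := by exact_mod_cast hjk
      have : (k : ℝ) ≤ n + 1 := by exact_mod_cast hk
      linarith
    have hj' : (0 : ℝ) < j := by exact_mod_cast (by omega : 0 < j)
    have := (add_eq_zero_iff_of_nonneg (mul_nonneg (mul_nonneg hj.le hq) (hb _))
      (mul_nonneg (by positivity) (hb _))).1 hdj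
    have h₁ : q = 0 ∨ b j = 0 := by simpa [hj.ne'] using this.1
    have h₂ : p = 0 ∨ b (j - 1) = 0 := by simpa [hj'.ne'] using this.2
    have f₁ : q * q * (b i * b k) = 0 := by
      rcases h₁ with h | h
      · simp [h]
      · rw [hz i j k hij.le hjk.le h, mul_zero]
    have f₂ : p * q * (b i * b (k - 1)) = 0 := by
      rcases h₁ with h | h
      · simp [h]
      · rw [hz i j (k - 1) hij.le (by omega) h, mul_zero]
    have f₃ : p * q * (b (i - 1) * b k) = 0 := by
      rcases h₁ with h | h
      · simp [h]
      · rw [hz (i - 1) j k (by omega) hjk.le h, mul_zero]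
    have f₄ : p * p * (b (i - 1) * b (k - 1)) = 0 := by
      rcases h₂ with h | h
      · simp [h]
      · rw [hz (i - 1) (j - 1) (k - 1) (by omega) (by omega) h, mul_zero]
    simp only [hd]
    linear_combination ((n : ℝ) + 1 - i) * (n + 1 - k) * f₁ + ((n : ℝ) + 1 - i) * k * f₂ +
      i * ((n : ℝ) + 1 - k) * f₃ + i * k * f₄

lemma isUltraLogConcave_C {c : ℝ} (hc : 0 ≤ c) : IsUltraLogConcave 0 (C c) := by
  refine ⟨fun j => if j = 0 then c else 0, fun j => ?_, fun j hj => ?_, fun j => ?_, fun j => ?_,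
    fun i j k hij hjk h => ?_⟩
  · dsimp only; split_ifs <;> simp [hc]
  · simp [hj.ne']
  · cases j <;> simp [coeff_C]
  · simp
  · rcases Nat.eq_zero_or_pos k with rfl | hk
    · obtain rfl : j = 0 := by omega
      simp_all
    · simp [hk.ne']

lemma isUltraLogConcave_prod {c : ℝ} (hc : 0 ≤ c) (s : Multiset ℝ) (hs : ∀ r ∈ s, r ≤ 0) :
    IsUltraLogConcave s.card (C c * (s.map fun r => X - C r).prod) := by
  induction s using Multiset.induction with
  | empty => simpa using isUltraLogConcave_C hc
  | cons r s ih =>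
    have := (ih fun x hx => hs x (Multiset.mem_cons_of_mem hx)).mul_linear (p := 1) (q := -r)
      zero_le_one (by linarith [hs r (Multiset.mem_cons_self r s)])
    rw [Multiset.card_cons, Multiset.map_cons, Multiset.prod_cons]
    convert this using 1
    simp only [map_one, map_neg]
    ring

lemma IsUltraLogConcave.mono {m n : ℕ} {P : ℝ[X]} (h : IsUltraLogConcave m P) (hmn : m ≤ n) :
    IsUltraLogConcave n P := by
  induction n, hmn using Nat.le_induction with
  | base => exact h
  | succ n _ ih => simpa using ih.mul_linear (p := 0) (q := 1) le_rfl zero_le_one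

/-- A positive term of a log-concave sequence without internal zeros admits a geometric
majorant of the sequence touching it there. -/
lemma exists_geometric_majorant {b : ℕ → ℝ} (hb : ∀ j, 0 ≤ b j)
    (hl : ∀ j, b j * b (j + 2) ≤ b (j + 1) ^ 2)
    (hz : ∀ i j k, i ≤ j → j ≤ k → b j = 0 → b i * b k = 0) {k : ℕ} (hk : 0 < k)
    (hbk : 0 < b k) : ∃ r, 0 < r ∧ ∀ j, b j * r ^ k ≤ b k * r ^ j := by
  obtain ⟨m, rfl⟩ : ∃ m, k = m + 1 := ⟨k - 1, by omega⟩
  obtain ⟨r, hr, hu, hd⟩ : ∃ r, 0 < r ∧ b (m + 2) ≤ r * b (m + 1) ∧ r * b m ≤ b (m + 1) := by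
    rcases (hb (m + 2)).eq_or_lt with h | h
    · rcases (hb m).eq_or_lt with h' | h'
      · exact ⟨1, one_pos, by linarith, by linarith⟩
      · refine ⟨b (m + 1) / b m, by positivity, ?_, ?_⟩
        · rw [← h]; positivity
        · rw [div_mul_cancel₀ _ h'.ne']
    · refine ⟨b (m + 2) / b (m + 1), by positivity, ?_, ?_⟩
      · rw [div_mul_cancel₀ _ hbk.ne']
      · rw [div_mul_eq_mul_div, div_le_iff₀ hbk]
        linarith [hl m]
  have up : ∀ i, b (m + 1 + i + 1) ≤ r * b (m + 1 + i) := fun i => by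
    induction i with
    | zero => exact hu
    | succ i ih =>
      rcases (hb (m + 1 + i)).eq_or_lt with h | h
      · have := hz (m + 1) (m + 1 + i) (m + 1 + i + 2) (by omega) (by omega) h.symm
        have := (mul_eq_zero.1 this).resolve_left hbk.ne'
        rw [show m + 1 + (i + 1) + 1 = m + 1 + i + 2 by ring, this]
        exact mul_nonneg hr.le (hb _)
      · refine le_of_mul_le_mul_left ?_ h
        have := hl (m + 1 + i)
        have := mul_le_mul_of_nonneg_right ih (hb (m + 1 + i + 1))
        rw [show m + 1 + (i + 1) + 1 = m + 1 + i + 2 by ring,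
          show m + 1 + (i + 1) = m + 1 + i + 1 by ring]
        linarith
  have down : ∀ i ≤ m, r * b i ≤ b (i + 1) := fun i hi => by
    induction hi using Nat.decreasingInduction with
    | self => exact hd
    | of_succ i hi ih =>
      rcases (hb (i + 2)).eq_or_lt with h | h
      · have := hz i (i + 2) (m + 1) (by omega) (by omega) h.symm
        have := (mul_eq_zero.1 this).resolve_right hbk.ne'
        rw [this, mul_zero]
        exact hb _
      · refine le_of_mul_le_mul_right ?_ h
        have := mul_le_mul_of_nonneg_left (hl i) hr.le
        have := mul_le_mul_of_nonneg_right ih (hb (i + 1))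
        rw [show i + 1 + 1 = i + 2 from rfl] at this
        linarith
  refine ⟨r, hr, fun j => ?_⟩
  rcases le_total (m + 1) j with h | h
  · obtain ⟨i, rfl⟩ := Nat.exists_eq_add_of_le h
    clear h
    induction i with
    | zero => simp
    | succ i ih =>
      have := mul_le_mul_of_nonneg_right (up i) (pow_nonneg hr.le (m + 1))
      have := mul_le_mul_of_nonneg_left ih hr.le
      rw [← add_assoc, pow_succ r (m + 1 + i)]
      linarith
  · induction h using Nat.decreasingInduction with
    | self => simp
    | of_succ i hi ih =>
      have := mul_le_mul_of_nonneg_right (down i (by omega)) (pow_nonneg hr.le (m + 1))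
      refine le_of_mul_le_mul_left ?_ hr
      rw [pow_succ r i] at ih
      linarith

/-- The generating function of a distribution with mean `k` dominates `x ^ k`. -/
lemma pow_mean_le_sum {n k : ℕ} {a : ℕ → ℝ} (hpos : ∀ j ≤ n, 0 ≤ a j)
    (hsum : ∑ j ∈ Finset.range (n + 1), a j = 1)
    (hmean : ∑ j ∈ Finset.range (n + 1), (j : ℝ) * a j = k) {x : ℝ} (hx : 0 < x) :
    x ^ k ≤ ∑ j ∈ Finset.range (n + 1), a j * x ^ j := by
  have key : ∀ j ∈ Finset.range (n + 1),
      x ^ k * (a j + ((j : ℝ) * a j - k * a j) * Real.log x) ≤ a j * x ^ j := fun j hj => by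
    have e : x ^ j = x ^ k * Real.exp (((j : ℝ) - k) * Real.log x) := by
      rw [sub_mul, Real.exp_sub, ← Real.log_pow, ← Real.log_pow, Real.exp_log (by positivity),
        Real.exp_log (by positivity)]
      field_simp
    have := Real.add_one_le_exp (((j : ℝ) - k) * Real.log x)
    have := mul_le_mul_of_nonneg_left this
      (mul_nonneg (pow_nonneg hx.le k) (hpos j (by simpa [Nat.lt_succ_iff] using hj)))
    rw [e]
    linarith
  have := Finset.sum_le_sum key
  rwa [← Finset.mul_sum, Finset.sum_add_distrib, ← Finset.sum_mul, Finset.sum_sub_distrib,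
    ← Finset.mul_sum, hsum, hmean, mul_one, sub_self, zero_mul, add_zero, mul_one] at this

/-- A real polynomial all of whose complex roots are real splits over `ℝ`. -/
lemma splits_of_forall_isRoot_im_eq_zero {P : ℝ[X]}
    (h : ∀ z : ℂ, (P.map (algebraMap ℝ ℂ)).IsRoot z → z.im = 0) : P.Splits := by
  refine Splits.of_splits_map (algebraMap ℝ ℂ) (IsAlgClosed.splits _) fun z hz => ?_
  exact ⟨z.re, Complex.ext rfl (by simpa using (h z (isRoot_of_mem_roots hz)).symm)⟩

/-- The generating polynomial of a real-rooted distribution is ultra-log-concave. -/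
lemma isUltraLogConcave_of_real_rooted {n k : ℕ} {a : ℕ → ℝ} (hpos : ∀ j ≤ n, 0 ≤ a j)
    (hsum : ∑ j ∈ Finset.range (n + 1), a j = 1)
    (hmean : ∑ j ∈ Finset.range (n + 1), (j : ℝ) * a j = k)
    (hroots : ∀ z : ℂ,
      ((∑ j ∈ Finset.range (n + 1), C (a j) * X ^ j).map (algebraMap ℝ ℂ)).IsRoot z → z.im = 0) :
    IsUltraLogConcave n (∑ j ∈ Finset.range (n + 1), C (a j) * X ^ j) := by
  have hsplit := splits_of_forall_isRoot_im_eq_zero hroots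
  set P : ℝ[X] := ∑ j ∈ Finset.range (n + 1), C (a j) * X ^ j with hP
  have hdeg : P.natDegree ≤ n := natDegree_sum_le_of_forall_le _ _ fun j hj =>
    (natDegree_C_mul_X_pow_le _ _).trans (by simpa [Nat.lt_succ_iff] using hj)
  have hcoeff : ∀ j, 0 ≤ P.coeff j := fun j => by
    simp only [hP, finsetSum_coeff, coeff_C_mul_X_pow]
    refine Finset.sum_nonneg fun i hi => ?_
    split_ifs
    · exact hpos i (by simpa [Nat.lt_succ_iff] using hi)
    · exact le_rfl
  have hr : ∀ r ∈ P.roots, r ≤ 0 := fun r hr => by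
    by_contra! h
    have h₁ := pow_mean_le_sum hpos hsum hmean h
    have h₂ : P.eval r = 0 := isRoot_of_mem_roots hr
    simp only [hP, eval_finsetSum, eval_mul, eval_C, eval_pow, eval_X] at h₂
    linarith [pow_pos h k]
  have := isUltraLogConcave_prod (hcoeff P.natDegree) P.roots hr
  rw [coeff_natDegree, ← hsplit.eq_prod_roots] at this
  exact this.mono ((card_roots' P).trans hdeg)

/-- If `b` has a geometric majorant touching it at `k` and the generating function of
`choose n j * b j` dominates `x ^ k`, then `b k` is at least the binomial weight of mean `k`. -/
lemma choose_mul_pow_le_of_geometric_majorant {n k : ℕ} (hkn : k < n) (hk : 0 < k)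
    {b : ℕ → ℝ} {r : ℝ} (hr : 0 < r) (hb : ∀ j, b j * r ^ k ≤ b k * r ^ j)
    (hcap : ∀ x : ℝ, 0 < x → x ^ k ≤ ∑ j ∈ Finset.range (n + 1), n.choose j * b j * x ^ j) :
    ((k : ℝ) / n) ^ k * (((n : ℝ) - k) / n) ^ (n - k) ≤ b k := by
  have hk' : (0 : ℝ) < k := by exact_mod_cast hk
  have hm : (0 : ℝ) < n - k := sub_pos.2 (by exact_mod_cast hkn)
  have hn : (0 : ℝ) < n := by linarith
  set s : ℝ := k / (n - k) with hs
  have hs0 : 0 < s := by positivity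
  have key : s ^ k ≤ b k * (s + 1) ^ n := by
    calc s ^ k = r ^ k * (s / r) ^ k := by rw [← mul_pow, mul_div_cancel₀ _ hr.ne']
      _ ≤ r ^ k * ∑ j ∈ Finset.range (n + 1), n.choose j * b j * (s / r) ^ j := by
        gcongr
        exact hcap _ (by positivity)
      _ ≤ b k * (s + 1) ^ n := by
        rw [add_pow, Finset.mul_sum, Finset.mul_sum]
        refine Finset.sum_le_sum fun j _ => ?_
        have := mul_le_mul_of_nonneg_left (hb j)
          (show 0 ≤ n.choose j * (s / r) ^ j by positivity)
        have e : s ^ j = r ^ j * (s / r) ^ j := by rw [← mul_pow, mul_div_cancel₀ _ hr.ne']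
        rw [one_pow, e]
        linarith
  have hs1 : s + 1 = n / (n - k) := by rw [hs]; field_simp; ring
  rw [hs1, ← div_le_iff₀ (by positivity)] at key
  refine le_of_eq_of_le ?_ key
  obtain ⟨m, rfl⟩ := Nat.exists_eq_add_of_le hkn.le
  rw [Nat.add_sub_cancel_left, hs, div_pow, div_pow, div_pow, div_pow, pow_add, pow_add]
  field_simp

/-- Darroch/Hoeffding-type bound: if `(a_0, …, a_n)` is a probability distribution with
mean `k` whose generating polynomial has only real roots, then
`a_k ≥ binom(n,k) (k/n)^k ((n-k)/n)^(n-k)`. -/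
theorem real_rooted_distribution_mode_bound (n : ℕ) (hn : 1 ≤ n) (k : ℕ) (hk : k ≤ n)
    (a : ℕ → ℝ) (hpos : ∀ j ≤ n, 0 ≤ a j)
    (hsum : ∑ j ∈ Finset.range (n + 1), a j = 1)
    (hmean : ∑ j ∈ Finset.range (n + 1), (j : ℝ) * a j = k)
    (hroots : ∀ z : ℂ,
      ((∑ j ∈ Finset.range (n + 1), Polynomial.C (a j) * Polynomial.X ^ j).map
          (algebraMap ℝ ℂ)).IsRoot z → z.im = 0) :
    (n.choose k : ℝ) * ((k : ℝ) / n) ^ k * (((n : ℝ) - k) / n) ^ (n - k) ≤ a k := by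
  have hvar : ∑ j ∈ Finset.range (n + 1), ((j : ℝ) - k) * a j = 0 := by
    simp only [sub_mul, Finset.sum_sub_distrib, ← Finset.mul_sum, hsum, hmean]
    ring
  have hn0 : (n : ℝ) ≠ 0 := by positivity
  have concentrated : (∀ j ≤ n, j ≠ k → a j = 0) → a k = 1 := fun h => by
    rw [← hsum, Finset.sum_eq_single_of_mem k (by simpa [Nat.lt_succ_iff] using hk)]
    exact fun j hj => h j (by simpa [Nat.lt_succ_iff] using hj)
  have lower : (∀ j ≤ n, k < j → a j = 0) → a k = 1 := fun h => concentrated fun j hj hjk => by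
    have hle : ∀ i ∈ Finset.range (n + 1), ((i : ℝ) - k) * a i ≤ 0 := fun i hi => by
      have hi : i ≤ n := by simpa [Nat.lt_succ_iff] using hi
      rcases le_or_gt i k with hik | hik
      · exact mul_nonpos_of_nonpos_of_nonneg (sub_nonpos.2 (by exact_mod_cast hik)) (hpos i hi)
      · rw [h i hi hik, mul_zero]
    have := (Finset.sum_eq_zero_iff_of_nonpos hle).1 hvar j (by simpa [Nat.lt_succ_iff] using hj)
    exact (mul_eq_zero.1 this).resolve_left (sub_ne_zero.2 (by exact_mod_cast hjk))
  have upper : (∀ j ≤ n, j < k → a j = 0) → a k = 1 := fun h => concentrated fun j hj hjk => by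
    have hle : ∀ i ∈ Finset.range (n + 1), 0 ≤ ((i : ℝ) - k) * a i := fun i hi => by
      have hi : i ≤ n := by simpa [Nat.lt_succ_iff] using hi
      rcases le_or_gt k i with hik | hik
      · exact mul_nonneg (sub_nonneg.2 (by exact_mod_cast hik)) (hpos i hi)
      · rw [h i hi hik, mul_zero]
    have := (Finset.sum_eq_zero_iff_of_nonneg hle).1 hvar j (by simpa [Nat.lt_succ_iff] using hj)
    exact (mul_eq_zero.1 this).resolve_left (sub_ne_zero.2 (by exact_mod_cast hjk))
  rcases Nat.eq_zero_or_pos k with rfl | hk0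
  · rw [upper fun j _ hj => absurd hj (Nat.not_lt_zero j)]
    simp [hn0]
  rcases hk.eq_or_lt with rfl | hkn
  · rw [lower fun j hj hj' => absurd hj hj'.not_ge]
    simp [hn0]
  obtain ⟨b, hb, -, hc, hl, hz⟩ := isUltraLogConcave_of_real_rooted hpos hsum hmean hroots
  have hab : ∀ j ≤ n, a j = n.choose j * b j := fun j hj => by
    rw [← hc j]
    simp [coeff_X_pow, hj]
  have hbk : 0 < b k := by
    refine (hb k).lt_of_ne' fun h => ?_
    have hak : a k ≠ 1 := by simp [hab k hk, h]
    obtain ⟨j, hj, hjk, haj⟩ : ∃ j ≤ n, k < j ∧ a j ≠ 0 := by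
      by_contra! H
      exact hak (lower H)
    obtain ⟨i, hi, hik, hai⟩ : ∃ i ≤ n, i < k ∧ a i ≠ 0 := by
      by_contra! H
      exact hak (upper H)
    rw [hab j hj] at haj
    rw [hab i hi] at hai
    exact mul_ne_zero (right_ne_zero_of_mul hai) (right_ne_zero_of_mul haj)
      (hz i k j hik.le hjk.le h)
  obtain ⟨r, hr, hbr⟩ := exists_geometric_majorant hb hl hz hk0 hbk
  rw [hab k hk, mul_assoc]
  gcongr
  refine choose_mul_pow_le_of_geometric_majorant hkn hk0 hr hbr fun x hx => ?_
  refine (pow_mean_le_sum hpos hsum hmean hx).trans_eq (Finset.sum_congr rfl fun j hj => ?_)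
  rw [hab j (by simpa [Nat.lt_succ_iff] using hj)]
end

section
/- Let G be a finite simple graph on v ≥ 2 vertices, let k ≥ 0 be an integer, and suppose t > 0 is a real number satisfying t·M'(G,t) = k·M(G,t), where M'(G,t) is the derivative of M(G,·) at t. Then m_k(G)·t^k ≥ M(G,t)/v. -/
/-- The number of `k`-matchings of a simple graph `G`: the number of sets of `k`
pairwise disjoint edges of `G`. -/
noncomputable def matchCount {V : Type*} (G : SimpleGraph V) (k : ℕ) : ℕ :=
  Nat.card {s : Finset (Sym2 V) // ↑s ⊆ G.edgeSet ∧ s.card = k ∧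
    ∀ e ∈ s, ∀ f ∈ s, e ≠ f → ∀ v : V, v ∈ e → v ∉ f}

/-- The matching generating polynomial `M(G,t) = Σ_k m_k(G) t^k`.
(Since `m_k(G) = 0` for `k > v(G)`, the range of summation captures all terms.) -/
noncomputable def matchGen {V : Type*} [Fintype V] (G : SimpleGraph V) (t : ℝ) : ℝ :=
  ∑ k ∈ Finset.range (Fintype.card V + 1), (matchCount G k : ℝ) * t ^ k

open Finset Polynomial in
/-- A real polynomial with nonnegative leading coefficient, all of whose complex roots are real and
nonpositive, has nonnegative and log-concave coefficients. -/
theorem coeff_logConcave_of_roots_nonpos (n : ℕ) :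
    ∀ p : ℝ[X], p.natDegree = n → 0 ≤ p.leadingCoeff →
      (∀ z : ℂ, aeval z p = 0 → z.im = 0 ∧ z.re ≤ 0) →
      (∀ i, 0 ≤ p.coeff i) ∧
        ∀ i j, i ≤ j → p.coeff i * p.coeff (j + 2) ≤ p.coeff (i + 1) * p.coeff (j + 1) := by
  induction n with
  | zero =>
    intro p hn hp _
    rw [eq_C_of_natDegree_eq_zero hn] at hp ⊢
    simp only [leadingCoeff_C] at hp
    refine ⟨fun i => ?_, fun i j _ => ?_⟩
    · rw [coeff_C]; split_ifs <;> simp [hp]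
    · simp [coeff_C]
  | succ n ih =>
    intro p hn hp hroot
    have hp0 : p ≠ 0 := by rintro rfl; simp at hn
    obtain ⟨z, hz⟩ := IsAlgClosed.exists_aeval_eq_zero ℂ p
      (by rw [degree_eq_natDegree hp0, hn]; exact_mod_cast Nat.succ_ne_zero n)
    obtain ⟨him, hre⟩ := hroot z hz
    have hzr : z = algebraMap ℝ ℂ z.re := Complex.ext (by simp) (by simp [him])
    have hx : p.IsRoot z.re := by
      rw [hzr, aeval_algebraMap_apply] at hz
      simpa [IsRoot.def, coe_aeval_eq_eval] using hz
    obtain ⟨q, hq⟩ := dvd_iff_isRoot.mpr hx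
    obtain ⟨r, hr⟩ : ∃ r, r = -z.re := ⟨_, rfl⟩
    have hr0 : 0 ≤ r := by linarith
    have hq' : p = (X + C r) * q := by rw [hq, hr]; simp [sub_eq_add_neg]
    have hq0 : q ≠ 0 := by rintro rfl; simp [hq] at hp0
    have hdeg : q.natDegree = n := by
      rw [hq', natDegree_mul (X_add_C_ne_zero r) hq0, natDegree_X_add_C] at hn
      omega
    obtain ⟨hnn, hlc⟩ := ih q hdeg (by simpa [hq', leadingCoeff_mul] using hp)
      (fun w hw => hroot w (by rw [hq', map_mul, hw, mul_zero]))
    have hc0 : p.coeff 0 = r * q.coeff 0 := by rw [hq']; simp [mul_coeff_zero]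
    have hcs (i : ℕ) : p.coeff (i + 1) = q.coeff i + r * q.coeff (i + 1) := by
      rw [hq', add_mul, coeff_add, coeff_X_mul, coeff_C_mul]
    refine ⟨fun i => ?_, fun i j hij => ?_⟩
    · have := hnn i
      rcases i with _ | i
      · rw [hc0]; positivity
      · have := hnn i
        rw [hcs]; positivity
    · rcases i with _ | i
      · rw [hc0, hcs, hcs, hcs]
        have h1 := mul_le_mul_of_nonneg_left (hlc 0 j hij) (mul_nonneg hr0 hr0)
        have h2 := mul_nonneg (hnn 0) (hnn j)
        have h3 := mul_nonneg hr0 (mul_nonneg (hnn 1) (hnn j))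
        simp only [zero_add] at *
        nlinarith
      · obtain ⟨j, rfl⟩ : ∃ j', j = j' + 1 := ⟨j - 1, by omega⟩
        have hij' : i ≤ j := by omega
        have h1 := hlc i j hij'
        have h2 := mul_le_mul_of_nonneg_left (hlc (i + 1) (j + 1) hij) (mul_nonneg hr0 hr0)
        have h3 : q.coeff i * q.coeff (j + 3) ≤ q.coeff (i + 2) * q.coeff (j + 1) := by
          refine (hlc i (j + 1) (by omega)).trans ?_
          rcases hij'.eq_or_lt with rfl | hlt
          · exact (mul_comm _ _).le
          · exact hlc (i + 1) j hlt
        have h4 := mul_le_mul_of_nonneg_left h3 hr0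
        rw [hcs, hcs, hcs, hcs]
        simp only [add_assoc, Nat.reduceAdd] at *
        nlinarith

open Finset in
/-- A log-concave distribution supported on `N` points has mass at least `1 / N` at its mean,
provided that mean is an integer. -/
theorem sum_le_card_mul_of_logConcave {a : ℕ → ℝ} (ha : ∀ i, 0 ≤ a i) (ha0 : 0 < a 0)
    (hlc : ∀ i j, i ≤ j → a i * a (j + 2) ≤ a (i + 1) * a (j + 1)) {N : ℕ} (hN : 0 < N) (k : ℕ)
    (hmean : ∑ j ∈ range N, (j : ℝ) * a j = k * ∑ j ∈ range N, a j) :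
    ∑ j ∈ range N, a j ≤ N * a k := by
  have hN' : (1 : ℝ) ≤ N := by exact_mod_cast hN
  have hmean' : ∑ j ∈ range N, ((j : ℝ) - k) * a j = 0 := by
    simp only [sub_mul, sum_sub_distrib, ← mul_sum]
    linarith
  have hstep (j : ℕ) (hj : 0 < a (j + 1)) : 0 < a j := by
    rcases j with _ | j
    · exact ha0
    · have h := (mul_pos ha0 hj).trans_le (hlc 0 j (Nat.zero_le j))
      exact pos_of_mul_pos_right h (ha _)
  rcases (ha (k + 1)).eq_or_lt with hk | hk
  · have hzero (i : ℕ) : a (k + 1 + i) = 0 := by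
      induction i with
      | zero => exact hk.symm
      | succ i ih =>
        by_contra h
        exact (hstep (k + 1 + i) (lt_of_le_of_ne (ha _) (Ne.symm h))).ne' ih
    have hterm : ∀ j ∈ range N, 0 ≤ ((k : ℝ) - j) * a j := by
      intro j _
      rcases le_or_gt j k with hjk | hjk
      · have : (j : ℝ) ≤ k := by exact_mod_cast hjk
        exact mul_nonneg (by linarith) (ha j)
      · obtain ⟨i, rfl⟩ := Nat.exists_eq_add_of_le (Nat.succ_le_of_lt hjk)
        simp [hzero]
    have hsum : ∑ j ∈ range N, ((k : ℝ) - j) * a j = 0 := by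
      rw [← neg_eq_zero, ← sum_neg_distrib, ← hmean']
      exact sum_congr rfl fun j _ => by ring
    rw [sum_eq_zero_iff_of_nonneg hterm] at hsum
    have hle : ∑ j ∈ range N, a j ≤ a k := by
      calc ∑ j ∈ range N, a j ≤ ∑ j ∈ range N, if j = k then a k else 0 := by
            refine sum_le_sum fun j hj => ?_
            split_ifs with h
            · rw [h]
            · have := hsum j hj
              have hne : (k : ℝ) - j ≠ 0 := sub_ne_zero.mpr (by exact_mod_cast Ne.symm h)
              exact ((mul_eq_zero.mp this).resolve_left hne).le
        _ ≤ a k := by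
            rw [sum_ite_eq' (range N) k (fun _ => a k)]
            split_ifs
            exacts [le_rfl, ha k]
    nlinarith [ha k]
  · have hkpos := hstep k hk
    have hup (i : ℕ) : a (k + i) * a k ^ i ≤ a k * a (k + 1) ^ i := by
      induction i with
      | zero => simp
      | succ i ih =>
        have h : a (k + i + 1) * a k ≤ a (k + 1) * a (k + i) := by
          rcases i with _ | i
          · exact (mul_comm _ _).le.trans' (by simp [mul_comm])
          · have := hlc k (k + i) (by omega)
            rw [mul_comm]
            exact this
        calc a (k + (i + 1)) * a k ^ (i + 1) = a (k + i + 1) * a k * a k ^ i := by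
              rw [pow_succ, ← add_assoc]; ring
          _ ≤ a (k + 1) * a (k + i) * a k ^ i := by gcongr
          _ = a (k + 1) * (a (k + i) * a k ^ i) := by ring
          _ ≤ a (k + 1) * (a k * a (k + 1) ^ i) := by gcongr
          _ = a k * a (k + 1) ^ (i + 1) := by ring
    have hdown (i j : ℕ) (hij : j + i = k) : a j * a (k + 1) ^ i ≤ a k * a k ^ i := by
      induction i generalizing j with
      | zero => simp [← hij]
      | succ i ih =>
        have h : a j * a (k + 1) ≤ a (j + 1) * a k := by
          obtain ⟨k', rfl⟩ : ∃ k', k = k' + 1 := ⟨k - 1, by omega⟩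
          exact hlc j k' (by omega)
        calc a j * a (k + 1) ^ (i + 1) = a j * a (k + 1) * a (k + 1) ^ i := by ring
          _ ≤ a (j + 1) * a k * a (k + 1) ^ i := by gcongr
          _ = a k * (a (j + 1) * a (k + 1) ^ i) := by ring
          _ ≤ a k * (a k * a k ^ i) := mul_le_mul_of_nonneg_left (ih (j + 1) (by omega)) hkpos.le
          _ = a k * a k ^ (i + 1) := by ring
    obtain ⟨l, hl⟩ : ∃ l, l = Real.log (a (k + 1)) - Real.log (a k) := ⟨_, rfl⟩
    have hlog (j : ℕ) (hj : 0 < a j) : Real.log (a j) ≤ Real.log (a k) + ((j : ℝ) - k) * l := by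
      rcases le_total k j with h | h
      · obtain ⟨i, rfl⟩ := Nat.exists_eq_add_of_le h
        have := Real.log_le_log (by positivity) (hup i)
        rw [Real.log_mul (by positivity) (by positivity),
          Real.log_mul (by positivity) (by positivity), Real.log_pow, Real.log_pow] at this
        push_cast
        rw [hl]
        linarith
      · obtain ⟨i, hi⟩ := Nat.exists_eq_add_of_le h
        have := Real.log_le_log (by positivity) (hdown i j hi.symm)
        rw [Real.log_mul (by positivity) (by positivity),
          Real.log_mul (by positivity) (by positivity), Real.log_pow, Real.log_pow] at this
        have hi' : (k : ℝ) = j + i := by exact_mod_cast hi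
        rw [hl, hi']
        linarith
    obtain ⟨A, hA⟩ : ∃ A, A = ∑ j ∈ range N, a j := ⟨_, rfl⟩
    have hApos : 0 < A := by
      rw [hA]
      exact sum_pos' (fun i _ => ha i) ⟨0, mem_range.mpr hN, ha0⟩
    have hNpos : (0 : ℝ) < N := by linarith
    have hmain : ∀ j ∈ range N, a j * Real.log (A / N) + a j - A / N ≤
        a j * Real.log (a k) + ((j : ℝ) - k) * a j * l := by
      intro j _
      rcases (ha j).eq_or_lt with h | h
      · rw [← h]
        have : 0 < A / N := by positivity
        linarith
      · have h1 := mul_le_mul_of_nonneg_left (hlog j h) h.le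
        have h2 := Real.one_sub_inv_le_log_of_pos (x := a j / (A / N)) (by positivity)
        rw [Real.log_div (by positivity) (by positivity), inv_div] at h2
        have h3 := mul_le_mul_of_nonneg_left h2 h.le
        have h4 : a j * (1 - A / N / a j) = a j - A / N := by field_simp
        rw [h4] at h3
        linarith
    have hS := sum_le_sum hmain
    rw [sum_sub_distrib, sum_add_distrib, sum_add_distrib, ← sum_mul, ← sum_mul, ← sum_mul,
      hmean', ← hA, sum_const, card_range, nsmul_eq_mul, mul_div_cancel₀ _ hNpos.ne'] at hS
    have hfin : Real.log (A / N) ≤ Real.log (a k) := by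
      refine le_of_mul_le_mul_left ?_ hApos
      linarith
    have := (Real.log_le_log_iff (by positivity) hkpos).mp hfin
    rw [div_le_iff₀ hNpos] at this
    rw [← hA]
    linarith

open Finset Classical in
/-- The matchings of `G` all of whose edges lie inside the vertex set `S`. -/
noncomputable def matchingsWithin {V : Type*} [Fintype V] (G : SimpleGraph V) (S : Finset V) :
    Finset (Finset (Sym2 V)) :=
  {s | ↑s ⊆ G.edgeSet ∧ (∀ e ∈ s, ∀ f ∈ s, e ≠ f → ∀ v : V, v ∈ e → v ∉ f) ∧
    ∀ e ∈ s, ∀ v ∈ e, v ∈ S}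

theorem mem_matchingsWithin {V : Type*} [Fintype V] {G : SimpleGraph V} {S : Finset V}
    {s : Finset (Sym2 V)} :
    s ∈ matchingsWithin G S ↔ (∀ e ∈ s, e ∈ G.edgeSet) ∧
      (∀ e ∈ s, ∀ f ∈ s, e ≠ f → ∀ v : V, v ∈ e → v ∉ f) ∧ ∀ e ∈ s, ∀ v ∈ e, v ∈ S := by
  classical
  rw [matchingsWithin, Finset.mem_filter_univ]
  rfl

theorem two_mul_card_le_of_mem_matchingsWithin {V : Type*} [Fintype V] {G : SimpleGraph V}
    {S : Finset V} {s : Finset (Sym2 V)} (hs : s ∈ matchingsWithin G S) :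
    2 * s.card ≤ S.card := by
  classical
  obtain ⟨hE, hD, hS⟩ := mem_matchingsWithin.mp hs
  have hcard : (s.biUnion Sym2.toFinset).card = ∑ e ∈ s, 2 := by
    rw [Finset.card_biUnion]
    · refine Finset.sum_congr rfl fun e he => ?_
      exact Sym2.card_toFinset_of_not_isDiag e (G.not_isDiag_of_mem_edgeSet (hE e he))
    · intro e he f hf hef
      rw [Function.onFun, Finset.disjoint_left]
      intro v hv hv'
      exact hD e he f hf hef v (Sym2.mem_toFinset.mp hv) (Sym2.mem_toFinset.mp hv')
  have hsub : s.biUnion Sym2.toFinset ⊆ S := by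
    intro v hv
    obtain ⟨e, he, hve⟩ := Finset.mem_biUnion.mp hv
    exact hS e he v (Sym2.mem_toFinset.mp hve)
  have := Finset.card_le_card hsub
  rw [hcard] at this
  simpa [mul_comm] using this

open Finset Classical in
theorem matchingsWithin_eq_union {V : Type*} [Fintype V] (G : SimpleGraph V) {S : Finset V}
    {v : V} (hv : v ∈ S) :
    matchingsWithin G S = matchingsWithin G (S.erase v) ∪
      ((S.erase v).filter (G.Adj v)).biUnion fun u =>
        (matchingsWithin G ((S.erase v).erase u)).image (insert s(v, u)) := by
  ext s
  simp only [mem_union, mem_biUnion, mem_image, mem_filter]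
  constructor
  · intro hs
    obtain ⟨hE, hD, hS⟩ := mem_matchingsWithin.mp hs
    by_cases h : ∃ e ∈ s, v ∈ e
    · right
      obtain ⟨e, he, hve⟩ := h
      obtain ⟨u, rfl⟩ := Sym2.mem_iff_exists.mp hve
      have hadj : G.Adj v u := hE _ he
      refine ⟨u, ⟨mem_erase.mpr ⟨hadj.ne', hS _ he u (Sym2.mem_mk_right v u)⟩, hadj⟩,
        s.erase s(v, u), mem_matchingsWithin.mpr ⟨fun f hf => hE f (mem_of_mem_erase hf),
          fun f hf g hg => hD f (mem_of_mem_erase hf) g (mem_of_mem_erase hg), ?_⟩,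
        insert_erase he⟩
      intro f hf x hx
      obtain ⟨hne, hfs⟩ := mem_erase.mp hf
      refine mem_erase.mpr ⟨?_, mem_erase.mpr ⟨?_, hS f hfs x hx⟩⟩
      · rintro rfl
        exact hD f hfs _ he hne x hx (Sym2.mem_mk_right v x)
      · rintro rfl
        exact hD f hfs _ he hne x hx (Sym2.mem_mk_left x u)
    · left
      refine mem_matchingsWithin.mpr ⟨hE, hD, fun e he x hx => mem_erase.mpr ⟨?_, hS e he x hx⟩⟩
      rintro rfl
      exact h ⟨e, he, hx⟩
  · rintro (hs | ⟨u, ⟨hu, hadj⟩, s, hs, rfl⟩)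
    · obtain ⟨hE, hD, hS⟩ := mem_matchingsWithin.mp hs
      exact mem_matchingsWithin.mpr ⟨hE, hD, fun e he x hx => mem_of_mem_erase (hS e he x hx)⟩
    · obtain ⟨hE, hD, hS⟩ := mem_matchingsWithin.mp hs
      have havoid : ∀ e ∈ s, ∀ x ∈ e, x ∉ s(v, u) := by
        intro e he x hx hx'
        have := hS e he x hx
        rcases Sym2.mem_iff.mp hx' with rfl | rfl <;> simp at this
      refine mem_matchingsWithin.mpr ⟨?_, ?_, ?_⟩
      · intro e he
        rcases mem_insert.mp he with rfl | he
        exacts [hadj, hE e he]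
      · intro e he f hf hef x hx hx'
        rcases mem_insert.mp he with rfl | he <;> rcases mem_insert.mp hf with rfl | hf
        · exact hef rfl
        · exact havoid f hf x hx' hx
        · exact havoid e he x hx hx'
        · exact hD e he f hf hef x hx hx'
      · intro e he x hx
        rcases mem_insert.mp he with rfl | he
        · rcases Sym2.mem_iff.mp hx with rfl | rfl
          exacts [hv, mem_of_mem_erase hu]
        · exact mem_of_mem_erase (mem_of_mem_erase (hS e he x hx))

open Finset Classical in
theorem sum_matchingsWithin_eq {V : Type*} [Fintype V] (G : SimpleGraph V) {S : Finset V}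
    {v : V} (hv : v ∈ S) (z : ℂ) :
    ∑ s ∈ matchingsWithin G S, z ^ s.card = ∑ s ∈ matchingsWithin G (S.erase v), z ^ s.card +
      ∑ u ∈ (S.erase v).filter (G.Adj v),
        z * ∑ s ∈ matchingsWithin G ((S.erase v).erase u), z ^ s.card := by
  have hnotMem {u : V} {s : Finset (Sym2 V)}
      (hs : s ∈ matchingsWithin G ((S.erase v).erase u)) {e : Sym2 V} (he : e ∈ s) : v ∉ e := by
    intro hve
    have := (mem_matchingsWithin.mp hs).2.2 e he v hve
    simp at this
  rw [matchingsWithin_eq_union G hv, sum_union, sum_biUnion]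
  · congr 1
    refine sum_congr rfl fun u _ => ?_
    have hfresh {s : Finset (Sym2 V)} (hs : s ∈ matchingsWithin G ((S.erase v).erase u)) :
        s(v, u) ∉ s := fun h => hnotMem hs h (Sym2.mem_mk_left v u)
    rw [sum_image, mul_sum]
    · refine sum_congr rfl fun s hs => ?_
      rw [card_insert_of_notMem (hfresh hs), pow_succ']
    · intro s hs s' hs' h
      rw [← erase_insert (hfresh hs), ← erase_insert (hfresh hs')]
      exact congrArg (fun s => Finset.erase s s(v, u)) h
  · intro u _ w _ huw
    refine disjoint_left.mpr fun s hs hs' => ?_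
    obtain ⟨s₁, hs₁, rfl⟩ := mem_image.mp hs
    obtain ⟨s₂, hs₂, h⟩ := mem_image.mp hs'
    have hmem : s(v, w) ∈ insert s(v, u) s₁ := h ▸ mem_insert_self _ _
    rcases mem_insert.mp hmem with h' | h'
    · exact huw (Sym2.congr_right.mp h').symm
    · exact hnotMem hs₁ h' (Sym2.mem_mk_left v w)
  · refine disjoint_left.mpr fun s hs hs' => ?_
    obtain ⟨u, _, hs'⟩ := mem_biUnion.mp hs'
    obtain ⟨s₁, _, rfl⟩ := mem_image.mp hs'
    have := (mem_matchingsWithin.mp hs).2.2 _ (mem_insert_self _ _) v (Sym2.mem_mk_left v u)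
    simp at this

open Finset Classical in
/-- The Heilmann–Lieb zero-freeness: the matching generating polynomial does not vanish at squares
of complex numbers with positive real part. -/
theorem sum_matchingsWithin_ne_zero {V : Type*} [Fintype V] (G : SimpleGraph V) {w : ℂ}
    (hw : 0 < w.re) (S : Finset V) :
    ∑ s ∈ matchingsWithin G S, (w ^ 2) ^ s.card ≠ 0 ∧
      ∀ v ∈ S, 0 < ((∑ s ∈ matchingsWithin G S, (w ^ 2) ^ s.card) /
        (w * ∑ s ∈ matchingsWithin G (S.erase v), (w ^ 2) ^ s.card)).re := by
  have hw0 : w ≠ 0 := by rintro rfl; simp at hw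
  have hinv {x : ℂ} (hx : 0 < x.re) : 0 < (x⁻¹).re := by
    have : x ≠ 0 := by rintro rfl; simp at hx
    rw [Complex.inv_re]
    exact div_pos hx (Complex.normSq_pos.mpr this)
  induction S using Finset.strongInduction with
  | H S ih =>
    have hratio : ∀ v ∈ S, 0 < ((∑ s ∈ matchingsWithin G S, (w ^ 2) ^ s.card) /
        (w * ∑ s ∈ matchingsWithin G (S.erase v), (w ^ 2) ^ s.card)).re := by
      intro v hv
      obtain ⟨hne, hpos⟩ := ih _ (erase_ssubset hv)
      rw [sum_matchingsWithin_eq G hv, add_div, Complex.add_re,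
        sum_div (filter _ _), Complex.re_sum]
      refine add_pos_of_pos_of_nonneg ?_ (sum_nonneg fun u hu => ?_)
      · rw [div_mul_cancel_right₀ hne]
        exact hinv hw
      · have hu' := (mem_filter.mp hu).1
        refine (hinv (hpos u hu')).le.trans_eq (congrArg Complex.re ?_)
        rw [inv_div]
        field_simp
    refine ⟨?_, hratio⟩
    rcases S.eq_empty_or_nonempty with rfl | ⟨v, hv⟩
    · have : matchingsWithin G (∅ : Finset V) = {∅} := by
        ext s
        rw [mem_singleton]
        constructor
        · intro hs
          have := two_mul_card_le_of_mem_matchingsWithin hs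
          rw [← card_eq_zero]
          simpa using this
        · rintro rfl
          exact mem_matchingsWithin.mpr (by simp)
      simp [this]
    · intro h
      have := hratio v hv
      simp [h] at this

theorem matchCount_eq_card {V : Type*} [Fintype V] (G : SimpleGraph V) (k : ℕ) :
    matchCount G k = ((matchingsWithin G Finset.univ).filter (fun s => s.card = k)).card := by
  rw [matchCount, ← Nat.card_eq_finsetCard]
  refine Nat.card_congr (Equiv.subtypeEquivRight fun s => ?_)
  rw [Finset.mem_filter, mem_matchingsWithin]
  simp only [Finset.mem_univ, implies_true, and_true, Set.subset_def, Finset.mem_coe]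
  tauto

open Finset Polynomial in
theorem matchCount_logConcave {V : Type*} [Fintype V] (G : SimpleGraph V) (i j : ℕ) (hij : i ≤ j) :
    (matchCount G i : ℝ) * matchCount G (j + 2) ≤ matchCount G (i + 1) * matchCount G (j + 1) := by
  obtain ⟨p, hp⟩ : ∃ p : ℝ[X], p = ∑ s ∈ matchingsWithin G univ, X ^ s.card := ⟨_, rfl⟩
  have hcoeff (k : ℕ) : p.coeff k = matchCount G k := by
    rw [hp, matchCount_eq_card, finsetSum_coeff]
    simp [coeff_X_pow, eq_comm]
  have hlead : 0 ≤ p.leadingCoeff := by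
    rw [leadingCoeff, hcoeff]
    positivity
  have hroot (z : ℂ) (hz : aeval z p = 0) : z.im = 0 ∧ z.re ≤ 0 := by
    have hsum : ∑ s ∈ matchingsWithin G univ, z ^ s.card = 0 := by simpa [hp] using hz
    obtain ⟨w, rfl⟩ : ∃ w : ℂ, z = w ^ 2 := (IsAlgClosed.exists_pow_nat_eq z two_pos).imp
      fun _ => Eq.symm
    rcases lt_trichotomy w.re 0 with h | h | h
    · rw [← neg_sq w] at hsum
      exact absurd hsum (sum_matchingsWithin_ne_zero G (by simpa using h) univ).1
    · rw [sq, Complex.mul_im, Complex.mul_re, h]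
      simpa using mul_self_nonneg w.im
    · exact absurd hsum (sum_matchingsWithin_ne_zero G h univ).1
  simpa only [hcoeff] using (coeff_logConcave_of_roots_nonpos _ p rfl hlead hroot).2 i j hij

/-- If `t > 0` satisfies `t·M'(G,t) = k·M(G,t)`, then by Darroch's rule the term
`m_k(G) t^k` is the largest one, so `m_k(G) t^k ≥ M(G,t)/v`. -/
theorem dominant_term_at_critical_activity {V : Type*} [Fintype V] (G : SimpleGraph V)
    (hv : 2 ≤ Fintype.card V) (k : ℕ) (t : ℝ) (ht : 0 < t)
    (hcrit : t * deriv (fun s => matchGen G s) t = (k : ℝ) * matchGen G t) :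
    matchGen G t / (Fintype.card V : ℝ) ≤ (matchCount G k : ℝ) * t ^ k := by
  have hzero : matchCount G (Fintype.card V) = 0 := by
    rw [matchCount_eq_card, Finset.card_eq_zero, Finset.filter_eq_empty_iff]
    intro s hs h
    have := two_mul_card_le_of_mem_matchingsWithin hs
    rw [Finset.card_univ] at this
    omega
  have hone : 0 < matchCount G 0 := by
    rw [matchCount_eq_card, Finset.card_pos]
    exact ⟨∅, Finset.mem_filter.mpr ⟨mem_matchingsWithin.mpr (by simp), rfl⟩⟩
  have hgen : matchGen G t = ∑ j ∈ Finset.range (Fintype.card V), matchCount G j * t ^ j := by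
    rw [matchGen, Finset.sum_range_succ, hzero]
    simp
  have hder : t * deriv (fun s => matchGen G s) t =
      ∑ j ∈ Finset.range (Fintype.card V), (j : ℝ) * (matchCount G j * t ^ j) := by
    have h : HasDerivAt (fun s => matchGen G s) (∑ j ∈ Finset.range (Fintype.card V + 1),
        (matchCount G j : ℝ) * (j * t ^ (j - 1))) t :=
      HasDerivAt.fun_sum fun j _ => (hasDerivAt_pow j t).const_mul _
    rw [h.deriv, Finset.sum_range_succ, hzero, Nat.cast_zero, zero_mul, add_zero, Finset.mul_sum]
    refine Finset.sum_congr rfl fun j _ => ?_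
    rcases j with _ | j
    · simp
    · rw [Nat.add_sub_cancel, pow_succ]
      ring
  rw [div_le_iff₀ (by positivity), mul_comm, hgen]
  refine sum_le_card_mul_of_logConcave (a := fun j => (matchCount G j : ℝ) * t ^ j)
    (fun i => by positivity) (by simpa using hone) (fun i j hij => ?_) (by omega) k
    (by rw [← hder, hcrit, hgen])
  have := mul_le_mul_of_nonneg_right (matchCount_logConcave G i j hij)
    (pow_nonneg ht.le (i + j + 2))
  calc (matchCount G i : ℝ) * t ^ i * (matchCount G (j + 2) * t ^ (j + 2))
      = matchCount G i * matchCount G (j + 2) * t ^ (i + j + 2) := by ring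
    _ ≤ matchCount G (i + 1) * matchCount G (j + 1) * t ^ (i + j + 2) := this
    _ = matchCount G (i + 1) * t ^ (i + 1) * (matchCount G (j + 1) * t ^ (j + 1)) := by ring
end

section
/- Let G be a finite simple graph whose maximum degree is D. Then every complex root of the matching polynomial μ(G,x) is real, and if D ≥ 2 then every root lies in the interval [−2√(D−1), 2√(D−1)]. -/
/-- The matching polynomial `μ(G,x) = Σ_k (-1)^k m_k(G) x^(v-2k)`.
(Since `m_k(G) = 0` for `2k > v`, the range of summation captures all terms.) -/
noncomputable def matchingPoly {V : Type*} [Fintype V] (G : SimpleGraph V) :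
    Polynomial ℝ :=
  ∑ k ∈ Finset.range (Fintype.card V + 1),
    Polynomial.C ((-1 : ℝ) ^ k * (matchCount G k : ℝ)) *
      Polynomial.X ^ (Fintype.card V - 2 * k)

open Polynomial

/-- The matchings of `G` all of whose edges have both endpoints in `S`. -/
noncomputable def matchingsIn {V : Type*} [Fintype V] (G : SimpleGraph V) (S : Finset V) :
    Finset (Finset (Sym2 V)) := by
  classical
  exact {M | (↑M ⊆ G.edgeSet ∧ ∀ e ∈ M, ∀ f ∈ M, e ≠ f → ∀ v : V, v ∈ e → v ∉ f) ∧
    ∀ e ∈ M, ∀ v ∈ e, v ∈ S}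

/-- The vertices of `S` not covered by an edge of `M`. -/
noncomputable def uncovered {V : Type*} (S : Finset V) (M : Finset (Sym2 V)) : Finset V := by
  classical
  exact {v ∈ S | ∀ e ∈ M, v ∉ e}

/-- The value at `z` of the matching polynomial of the subgraph of `G` induced on `S`, as a sum
over matchings. -/
noncomputable def matchingSum {V : Type*} [Fintype V] (G : SimpleGraph V) (z : ℂ)
    (S : Finset V) : ℂ :=
  ∑ M ∈ matchingsIn G S, (-1) ^ M.card * z ^ (uncovered S M).card

theorem mem_uncovered {V : Type*} {S : Finset V} {M : Finset (Sym2 V)} {v : V} :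
    v ∈ uncovered S M ↔ v ∈ S ∧ ∀ e ∈ M, v ∉ e := by
  simp [uncovered]

section

variable {V : Type*} [Fintype V] (G : SimpleGraph V)

theorem mem_matchingsIn {S : Finset V} {M : Finset (Sym2 V)} :
    M ∈ matchingsIn G S ↔
      (↑M ⊆ G.edgeSet ∧ ∀ e ∈ M, ∀ f ∈ M, e ≠ f → ∀ v : V, v ∈ e → v ∉ f) ∧
        ∀ e ∈ M, ∀ v ∈ e, v ∈ S := by
  simp [matchingsIn]

theorem card_uncovered_univ_add {M : Finset (Sym2 V)} (hM : M ∈ matchingsIn G Finset.univ) :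
    (uncovered Finset.univ M).card + 2 * M.card = Fintype.card V := by
  classical
  obtain ⟨⟨hG, hdisj⟩, -⟩ := (mem_matchingsIn G).1 hM
  have hcov : (M.biUnion Sym2.toFinset).card = 2 * M.card := by
    rw [Finset.card_biUnion, Finset.sum_congr rfl (g := fun _ => 2), Finset.sum_const,
      smul_eq_mul, mul_comm]
    · exact fun e he => Sym2.card_toFinset_of_not_isDiag e (G.not_isDiag_of_mem_edgeSet (hG he))
    · intro e he f hf hne
      refine Finset.disjoint_left.2 ?_
      intro v hv hv'
      exact hdisj e he f hf hne v (Sym2.mem_toFinset.1 hv) (Sym2.mem_toFinset.1 hv')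
  have hunc : uncovered Finset.univ M = (M.biUnion Sym2.toFinset)ᶜ := by
    ext v
    simp [mem_uncovered]
  rw [hunc, ← hcov, Finset.card_compl_add_card]

theorem matchCount_eq_card_filter (k : ℕ) :
    matchCount G k = ((matchingsIn G Finset.univ).filter fun M => M.card = k).card := by
  classical
  rw [matchCount, Nat.card_eq_fintype_card, Fintype.card_subtype]
  congr 1
  ext M
  simp only [Finset.mem_filter, mem_matchingsIn, Finset.mem_univ]
  tauto

theorem aeval_matchingPoly (z : ℂ) :
    aeval z (matchingPoly G) = matchingSum G z Finset.univ := by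
  classical
  rw [matchingSum, ← Finset.sum_fiberwise_of_maps_to
    (s := matchingsIn G Finset.univ) (t := Finset.range (Fintype.card V + 1))
    (g := Finset.card), matchingPoly, map_sum]
  · refine Finset.sum_congr rfl fun k _ => ?_
    rw [Finset.sum_congr rfl (g := fun _ => (-1) ^ k * z ^ (Fintype.card V - 2 * k)),
      Finset.sum_const, ← matchCount_eq_card_filter]
    · simp
      ring
    · intro M hM
      obtain ⟨hmem, rfl⟩ := Finset.mem_filter.1 hM
      rw [← card_uncovered_univ_add G hmem, Nat.add_sub_cancel]
  · intro M hM
    have := card_uncovered_univ_add G hM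
    rw [Finset.mem_range]
    omega

@[simp]
theorem matchingSum_empty (z : ℂ) : matchingSum G z ∅ = 1 := by
  classical
  have : matchingsIn G ∅ = {∅} := by
    ext M
    rw [mem_matchingsIn, Finset.mem_singleton]
    constructor
    · rintro ⟨-, h⟩
      refine Finset.eq_empty_of_forall_notMem fun e he => ?_
      exact absurd (h e he _ e.out_fst_mem) (Finset.notMem_empty _)
    · rintro rfl
      simp
  simp [matchingSum, this, uncovered]

/-- Matchings leaving the new vertex uncovered. -/
theorem sum_matchings_not_covering [DecidableEq V] {S : Finset V} {v : V} (hv : v ∉ S) (z : ℂ) :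
    ∑ M ∈ matchingsIn G (insert v S) with ∀ e ∈ M, v ∉ e,
      (-1) ^ M.card * z ^ (uncovered (insert v S) M).card = z * matchingSum G z S := by
  have hset : (matchingsIn G (insert v S)).filter (fun M => ∀ e ∈ M, v ∉ e) =
      matchingsIn G S := by
    ext M
    simp only [Finset.mem_filter, mem_matchingsIn]
    constructor
    · rintro ⟨⟨h, h1⟩, h2⟩
      refine ⟨h, fun e he w hw => ?_⟩
      refine Finset.mem_of_mem_insert_of_ne (h1 e he w hw) ?_
      rintro rfl
      exact h2 e he hw
    · rintro ⟨h, h1⟩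
      exact ⟨⟨h, fun e he w hw => Finset.mem_insert_of_mem (h1 e he w hw)⟩,
        fun e he hw => hv (h1 e he v hw)⟩
  rw [hset, matchingSum, Finset.mul_sum]
  refine Finset.sum_congr rfl fun M hM => ?_
  have hM := ((mem_matchingsIn G).1 hM).2
  have hunc : uncovered (insert v S) M = insert v (uncovered S M) := by
    ext w
    simp only [mem_uncovered, Finset.mem_insert]
    constructor
    · tauto
    · rintro (rfl | h)
      · exact ⟨Or.inl rfl, fun e he hw => hv (hM e he _ hw)⟩
      · tauto
  rw [hunc, Finset.card_insert_of_notMem fun h => hv (mem_uncovered.1 h).1, pow_succ]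
  ring

/-- Matchings containing a given edge at the new vertex. -/
theorem sum_matchings_containing [DecidableEq V] {S : Finset V} {v u : V} (hv : v ∉ S)
    (hu : u ∈ S) (huv : G.Adj v u) (z : ℂ) :
    ∑ M ∈ matchingsIn G (insert v S) with s(v, u) ∈ M,
      (-1) ^ M.card * z ^ (uncovered (insert v S) M).card = -matchingSum G z (S.erase u) := by
  rw [matchingSum, ← Finset.sum_neg_distrib]
  refine Finset.sum_bij' (fun M _ => M.erase s(v, u)) (fun M _ => insert s(v, u) M) ?_ ?_ ?_ ?_ ?_
  · intro M hM
    simp only [Finset.mem_filter, mem_matchingsIn] at hM ⊢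
    obtain ⟨⟨⟨h1, h2⟩, h3⟩, h4⟩ := hM
    refine ⟨⟨fun e he => h1 (Finset.mem_of_mem_erase he), fun e he f hf =>
      h2 e (Finset.mem_of_mem_erase he) f (Finset.mem_of_mem_erase hf)⟩, fun e he w hw => ?_⟩
    obtain ⟨hne, he⟩ := Finset.mem_erase.1 he
    have hnot := h2 e he _ h4 hne w hw
    rw [Sym2.mem_iff, not_or] at hnot
    exact Finset.mem_erase.2 ⟨hnot.2, Finset.mem_of_mem_insert_of_ne (h3 e he w hw) hnot.1⟩
  · intro M hM
    simp only [Finset.mem_filter, mem_matchingsIn] at hM ⊢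
    obtain ⟨⟨h1, h2⟩, h3⟩ := hM
    have hnew : ∀ e ∈ M, ∀ w ∈ e, w ∉ s(v, u) := by
      intro e he w hw hw'
      obtain ⟨hwu, hwS⟩ := Finset.mem_erase.1 (h3 e he w hw)
      rcases Sym2.mem_iff.1 hw' with rfl | rfl
      · exact hv hwS
      · exact hwu rfl
    refine ⟨⟨⟨?_, ?_⟩, ?_⟩, Finset.mem_insert_self _ _⟩
    · intro e he
      rcases Finset.mem_insert.1 (Finset.mem_coe.1 he) with rfl | he
      · exact huv
      · exact h1 he
    · intro e he f hf hne w hw hw'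
      rcases Finset.mem_insert.1 he with rfl | he <;> rcases Finset.mem_insert.1 hf with rfl | hf
      · exact hne rfl
      · exact hnew f hf w hw' hw
      · exact hnew e he w hw hw'
      · exact h2 e he f hf hne w hw hw'
    · intro e he w hw
      rcases Finset.mem_insert.1 he with rfl | he
      · rcases Sym2.mem_iff.1 hw with rfl | rfl
        · exact Finset.mem_insert_self _ _
        · exact Finset.mem_insert_of_mem hu
      · exact Finset.mem_insert_of_mem (Finset.mem_of_mem_erase (h3 e he w hw))
  · intro M hM
    exact Finset.insert_erase (Finset.mem_filter.1 hM).2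
  · intro M hM
    refine Finset.erase_insert fun h => ?_
    exact hv (Finset.mem_of_mem_erase
      (((mem_matchingsIn G).1 hM).2 _ h v (Sym2.mem_mk_left v u)))
  · intro M hM
    obtain ⟨hM, huM⟩ := Finset.mem_filter.1 hM
    have hunc : uncovered (insert v S) M = uncovered (S.erase u) (M.erase s(v, u)) := by
      ext w
      simp only [mem_uncovered, Finset.mem_insert, Finset.mem_erase]
      constructor
      · rintro ⟨hw, h⟩
        have hnot := h _ huM
        rw [Sym2.mem_iff, not_or] at hnot
        exact ⟨⟨hnot.2, hw.resolve_left hnot.1⟩, fun e he => h e he.2⟩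
      · rintro ⟨⟨hwu, hw⟩, h⟩
        refine ⟨Or.inr hw, fun e he hwe => ?_⟩
        by_cases heq : e = s(v, u)
        · subst heq
          rcases Sym2.mem_iff.1 hwe with rfl | rfl
          · exact hv hw
          · exact hwu rfl
        · exact h e ⟨heq, he⟩ hwe
    rw [hunc, ← Finset.card_erase_add_one huM, pow_succ]
    ring

theorem matchingSum_insert [DecidableEq V] [DecidableRel G.Adj] {S : Finset V} {v : V}
    (hv : v ∉ S) (z : ℂ) :
    matchingSum G z (insert v S) =
      z * matchingSum G z S - ∑ u ∈ S with G.Adj v u, matchingSum G z (S.erase u) := by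
  rw [matchingSum, ← Finset.sum_filter_add_sum_filter_not _ (fun M => ∀ e ∈ M, v ∉ e),
    sum_matchings_not_covering G hv, sub_eq_add_neg, ← Finset.sum_neg_distrib]
  congr 1
  have hedge : ∀ u ∈ S.filter (G.Adj v), -matchingSum G z (S.erase u) =
      ∑ M ∈ matchingsIn G (insert v S) with s(v, u) ∈ M,
        (-1) ^ M.card * z ^ (uncovered (insert v S) M).card := fun u hu =>
    (sum_matchings_containing G hv (Finset.mem_filter.1 hu).1 (Finset.mem_filter.1 hu).2 z).symm
  rw [Finset.sum_congr rfl hedge, Finset.sum_comm'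
    (t' := (matchingsIn G (insert v S)).filter fun M => ¬∀ e ∈ M, v ∉ e)
    (s' := fun M => S.filter fun u => G.Adj v u ∧ s(v, u) ∈ M)]
  · refine Finset.sum_congr rfl fun M hM => ?_
    obtain ⟨hM, hcov⟩ := Finset.mem_filter.1 hM
    obtain ⟨⟨hG, hdisj⟩, hS⟩ := (mem_matchingsIn G).1 hM
    push Not at hcov
    obtain ⟨e, he, hve⟩ := hcov
    obtain ⟨u, rfl⟩ := Sym2.mem_iff_exists.1 hve
    have huv : G.Adj v u := hG he
    have hsingle : (S.filter fun w => G.Adj v w ∧ s(v, w) ∈ M) = {u} := by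
      ext w
      simp only [Finset.mem_filter, Finset.mem_singleton]
      constructor
      · rintro ⟨-, -, hw⟩
        by_contra hne
        refine hdisj _ hw _ he ?_ v (Sym2.mem_mk_left v w) hve
        rwa [Ne, Sym2.congr_right]
      · rintro rfl
        exact ⟨Finset.mem_of_mem_insert_of_ne (hS _ he w (Sym2.mem_mk_right v w)) huv.ne',
          huv, he⟩
    rw [hsingle, Finset.sum_singleton]
  · intro u M
    simp only [Finset.mem_filter]
    constructor
    · rintro ⟨⟨hu, huv⟩, hM, huM⟩
      exact ⟨⟨hu, huv, huM⟩, hM, fun h => h _ huM (Sym2.mem_mk_left v u)⟩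
    · tauto

theorem matchingSum_ratio [DecidableEq V] [DecidableRel G.Adj] {S : Finset V} {v : V}
    (hv : v ∉ S) {z : ℂ} (hS : matchingSum G z S ≠ 0) :
    matchingSum G z (insert v S) / matchingSum G z S =
      z - ∑ u ∈ S with G.Adj v u,
        (matchingSum G z (insert u (S.erase u)) / matchingSum G z (S.erase u))⁻¹ := by
  rw [matchingSum_insert G hv, sub_div, mul_div_cancel_right₀ _ hS, Finset.sum_div]
  congr 1
  refine Finset.sum_congr rfl fun u hu => ?_
  rw [inv_div, Finset.insert_erase (Finset.mem_filter.1 hu).1]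

theorem matchingSum_ne_zero_of_ratio_ne_zero [DecidableEq V] {S : Finset V} {z : ℂ}
    (h : ∀ T ⊂ S, ∀ v ∉ T, matchingSum G z (insert v T) / matchingSum G z T ≠ 0) :
    matchingSum G z S ≠ 0 := by
  rcases S.eq_empty_or_nonempty with rfl | ⟨v, hv⟩
  · simp
  · have := h (S.erase v) (Finset.erase_ssubset hv) v (Finset.notMem_erase v S)
    rw [Finset.insert_erase hv] at this
    exact (div_ne_zero_iff.1 this).1

theorem matchingSum_ne_zero_and_ratio_im_pos [DecidableEq V] {z : ℂ} (hz : 0 < z.im)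
    (S : Finset V) :
    matchingSum G z S ≠ 0 ∧
      ∀ v ∉ S, 0 < (matchingSum G z (insert v S) / matchingSum G z S).im := by
  classical
  induction S using Finset.strongInduction with
  | H S ih =>
    have hS : matchingSum G z S ≠ 0 :=
      matchingSum_ne_zero_of_ratio_ne_zero G fun T hT v hv h0 => by
        simpa [h0] using (ih T hT).2 v hv
    refine ⟨hS, fun v hv => ?_⟩
    rw [matchingSum_ratio G hv hS, Complex.sub_im, Complex.im_sum, sub_pos]
    refine (Finset.sum_nonpos fun u hu => ?_).trans_lt hz
    have hu := (Finset.mem_filter.1 hu).1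
    rw [Complex.inv_im]
    exact div_nonpos_of_nonpos_of_nonneg
      (neg_nonpos.2 ((ih _ (Finset.erase_ssubset hu)).2 u (Finset.notMem_erase u S)).le)
      (Complex.normSq_nonneg _)

theorem matchingSum_ne_zero_and_lt_norm_ratio [DecidableEq V] [DecidableRel G.Adj] {D : ℕ}
    (hD : 2 ≤ D) (hdeg : ∀ v, G.degree v ≤ D) {z : ℂ}
    (hz : 2 * Real.sqrt ((D : ℝ) - 1) < ‖z‖) (S : Finset V) :
    matchingSum G z S ≠ 0 ∧ ∀ v ∉ S,
      matchingSum G z (insert v S) / matchingSum G z S ≠ 0 ∧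
        ((S.filter (G.Adj v)).card < D →
          Real.sqrt ((D : ℝ) - 1) < ‖matchingSum G z (insert v S) / matchingSum G z S‖) := by
  have hD' : (2 : ℝ) ≤ D := by exact_mod_cast hD
  set s := Real.sqrt ((D : ℝ) - 1) with hs
  have hsq : s * s = D - 1 := Real.mul_self_sqrt (by linarith)
  have hs1 : 1 ≤ s := Real.one_le_sqrt.2 (by linarith)
  have hinv : s * s⁻¹ = 1 := mul_inv_cancel₀ (by positivity)
  have hinv0 : 0 ≤ s⁻¹ := by positivity
  induction S using Finset.strongInduction with
  | H S ih =>
    have hS : matchingSum G z S ≠ 0 :=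
      matchingSum_ne_zero_of_ratio_ne_zero G fun T hT v hv => ((ih T hT).2 v hv).1
    refine ⟨hS, fun v hv => ?_⟩
    have hbound : ‖z‖ - (S.filter (G.Adj v)).card * s⁻¹ ≤
        ‖matchingSum G z (insert v S) / matchingSum G z S‖ := by
      rw [matchingSum_ratio G hv hS]
      refine le_trans (sub_le_sub_left ?_ _) (norm_sub_norm_le _ _)
      refine (norm_sum_le_of_le _ (n := fun _ => s⁻¹) fun u hu => ?_).trans_eq ?_
      · obtain ⟨hu, huv⟩ := Finset.mem_filter.1 hu
        rw [norm_inv]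
        refine inv_anti₀ (by positivity)
          (((ih _ (Finset.erase_ssubset hu)).2 u (Finset.notMem_erase u S)).2 ?_).le
        refine lt_of_lt_of_le (Finset.card_lt_card ?_) (hdeg u)
        refine Finset.ssubset_iff_subset_ne.2 ⟨fun w hw => ?_, fun heq => ?_⟩
        · simpa using (Finset.mem_filter.1 hw).2
        · have hmem : v ∈ G.neighborFinset u := by simpa using huv.symm
          rw [← heq] at hmem
          exact hv (Finset.mem_of_mem_erase (Finset.mem_filter.1 hmem).1)
      · simp
    refine ⟨norm_pos_iff.1 (lt_of_lt_of_le ?_ hbound), fun hcard => lt_of_lt_of_le ?_ hbound⟩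
    · have hcard : (S.filter (G.Adj v)).card ≤ D :=
        (Finset.card_le_card fun w hw => by simpa using (Finset.mem_filter.1 hw).2).trans (hdeg v)
      have hcard' : ((S.filter (G.Adj v)).card : ℝ) ≤ s * s + 1 := by
        rw [hsq, sub_add_cancel]
        exact_mod_cast hcard
      have := mul_le_mul_of_nonneg_right hcard' hinv0
      have : s⁻¹ ≤ 1 := inv_le_one_of_one_le₀ hs1
      have : (s * s + 1) * s⁻¹ = s + s⁻¹ := by rw [add_mul, mul_assoc, hinv]; ring
      linarith
    · have hcard' : ((S.filter (G.Adj v)).card : ℝ) ≤ s * s := by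
        rw [hsq, le_sub_iff_add_le]
        exact_mod_cast hcard
      have := mul_le_mul_of_nonneg_right hcard' hinv0
      have : s * s * s⁻¹ = s := by rw [mul_assoc, hinv, mul_one]
      linarith

end

/-- **Heilmann–Lieb theorem.** All complex roots of the matching polynomial are real,
and if the maximum degree `D` is at least `2`, then every root lies in the interval
`[-2√(D-1), 2√(D-1)]`. -/
theorem heilmann_lieb {V : Type*} [Fintype V] (G : SimpleGraph V) [DecidableRel G.Adj]
    (D : ℕ) (hD : G.maxDegree = D) :
    (∀ z : ℂ, ((matchingPoly G).map (algebraMap ℝ ℂ)).IsRoot z → z.im = 0) ∧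
    (2 ≤ D → ∀ x : ℝ, (matchingPoly G).IsRoot x →
      |x| ≤ 2 * Real.sqrt ((D : ℝ) - 1)) := by
  classical
  refine ⟨fun z hz => ?_, fun h x hx => ?_⟩
  · have hroot : aeval z (matchingPoly G) = 0 := by
      rwa [IsRoot.def, eval_map_algebraMap] at hz
    rcases lt_trichotomy z.im 0 with him | him | him
    · refine absurd ?_ (matchingSum_ne_zero_and_ratio_im_pos G
        (z := (starRingEnd ℂ) z) (by simpa using him) Finset.univ).1
      rw [← aeval_matchingPoly, aeval_conj, hroot, map_zero]
    · exact him
    · exact absurd ((aeval_matchingPoly G z).symm.trans hroot)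
        (matchingSum_ne_zero_and_ratio_im_pos G him Finset.univ).1
  · by_contra! hlt
    refine (matchingSum_ne_zero_and_lt_norm_ratio G h
      (fun v => hD ▸ G.degree_le_maxDegree v) (z := x) (by simpa using hlt) Finset.univ).1 ?_
    rw [← aeval_matchingPoly]
    have := aeval_algebraMap_apply ℂ x (matchingPoly G)
    rw [Complex.coe_algebraMap] at this
    rw [this, coe_aeval_eq_eval, hx.eq_zero, Complex.ofReal_zero]
end
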